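/- arXiv:2103.05089 — 4 statements merged into one kernel-verified Lean document; each statement's English description precedes it below -/
import Mathlib

section
/- Let μ be a positive Borel measure on [0,∞) with μ({0}) = 0, μ([0,1]) < ∞ and ∫₁^∞ x⁻¹ μ(dx) < ∞, and let m, λ, β > 0. For ω > 0 define 𝒦cos(ω) = ∫₀^∞ x/(x² + ω²) μ(dx) and 𝒦sin(ω) = ∫₀^∞ ω/(x² + ω²) μ(dx). Then ∫₀^∞ 2(λ + β·𝒦cos(ω)) / ((m·ω − β·𝒦sin(ω))² + (λ + β·𝒦cos(ω))²) dω = π/m. (This is the analytic content of equipartition of energy E[m v(0)²] = k_B T for the free-particle generalized Langevin equation with a completely monotonic memory kernel: the velocity spectral density for γ = 0 is r₂₂(ω) = 2(λ + β𝒦cos(ω)) / ((mω − β𝒦sin(ω))² + (λ + β𝒦cos(ω))²) and E[v(0)²] = (k_B T/π)∫₀^∞ r₂₂(ω) dω.) -/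
open MeasureTheory Filter Set

lemma aux_norm_sq (x : ℝ) (z : ℂ) : ‖(x:ℂ) + z‖ ^ 2 = x ^ 2 + 2 * x * z.re + ‖z‖ ^ 2 := by
  rw [← Complex.normSq_eq_norm_sq, ← Complex.normSq_eq_norm_sq, Complex.normSq_apply,
    Complex.normSq_apply]
  simp
  ring

lemma aux_norm_ge (x : ℝ) (hx : 0 ≤ x) (z : ℂ) (hz : 0 ≤ z.re) : max x ‖z‖ ≤ ‖(x:ℂ) + z‖ := by
  have h := aux_norm_sq x z
  have h1 : 0 ≤ x * z.re := mul_nonneg hx hz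
  apply max_le
  · refine (pow_le_pow_iff_left₀ (by first | exact hx | exact norm_nonneg _) (norm_nonneg _) two_ne_zero).1 ?_
    nlinarith [sq_nonneg ‖z‖]
  · refine (pow_le_pow_iff_left₀ (by first | exact hx | exact norm_nonneg _) (norm_nonneg _) two_ne_zero).1 ?_
    nlinarith [sq_nonneg x]

lemma aux_integrable (μ : Measure ℝ) (hμ01 : μ (Icc (0:ℝ) 1) < ⊤)
    (hμint : IntegrableOn (fun x : ℝ => x⁻¹) (Ici 1) μ) :
    IntegrableOn (fun x : ℝ => (max x 1)⁻¹) (Ici 0) μ := by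
  have : Ici (0:ℝ) = Icc 0 1 ∪ Ici 1 := by
    ext x; simp only [mem_Ici, mem_union, mem_Icc]
    constructor
    · intro h; rcases le_total x 1 with h1 | h1
      · exact Or.inl ⟨h, h1⟩
      · exact Or.inr h1
    · rintro (h | h) <;> linarith
  rw [this]
  refine IntegrableOn.union ?_ ?_
  · have h1 : IntegrableOn (fun _ : ℝ => (1:ℝ)) (Icc 0 1) μ := by
      apply integrableOn_const hμ01.ne
    refine h1.congr_fun (fun x hx => ?_) measurableSet_Icc
    simp [max_eq_right hx.2]
  · refine hμint.congr_fun (fun x hx => ?_) measurableSet_Ici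
    simp [max_eq_left (mem_Ici.1 hx)]

lemma aux_max (x r : ℝ) (hr : 0 < r) : min 1 r * max x 1 ≤ max x r := by
  have h0 : 0 < min 1 r := lt_min one_pos hr
  rcases le_total x 1 with h | h
  · rw [max_eq_right h, mul_one]
    exact (min_le_right _ _).trans (le_max_right _ _)
  · rw [max_eq_left h]
    refine le_trans ?_ (le_max_left _ _)
    nlinarith [min_le_left 1 r]

lemma aux_norm_inv (x : ℝ) (hx : 0 ≤ x) (z : ℂ) (hz : 0 ≤ z.re) (hz0 : z ≠ 0) :
    ‖((x:ℂ) + z)⁻¹‖ ≤ (min 1 ‖z‖)⁻¹ * (max x 1)⁻¹ := by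
  have hr : 0 < ‖z‖ := norm_pos_iff.2 hz0
  have h0 : 0 < min 1 ‖z‖ := lt_min one_pos hr
  have h1 : 0 < max x 1 := lt_of_lt_of_le one_pos (le_max_right _ _)
  rw [norm_inv, ← mul_inv]
  exact inv_anti₀ (mul_pos h0 h1) ((aux_max x _ hr).trans (aux_norm_ge x hx z hz))

lemma aux_meas (z : ℂ) (ν : Measure ℝ) :
    AEStronglyMeasurable (fun x : ℝ => ((x:ℂ) + z)⁻¹) ν := by
  apply Measurable.aestronglyMeasurable
  fun_prop

lemma aux_int_inv (μ : Measure ℝ) (hμ01 : μ (Icc (0:ℝ) 1) < ⊤)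
    (hμint : IntegrableOn (fun x : ℝ => x⁻¹) (Ici 1) μ) (z : ℂ) (hz : 0 ≤ z.re) (hz0 : z ≠ 0) :
    IntegrableOn (fun x : ℝ => ((x:ℂ) + z)⁻¹) (Ici 0) μ := by
  refine Integrable.mono' ((aux_integrable μ hμ01 hμint).const_mul (min 1 ‖z‖)⁻¹) (aux_meas _ _) ?_
  filter_upwards [ae_restrict_mem measurableSet_Ici] with x hx
  exact aux_norm_inv x hx z hz hz0

lemma aux_diff (μ : Measure ℝ) (hμ01 : μ (Icc (0:ℝ) 1) < ⊤)
    (hμint : IntegrableOn (fun x : ℝ => x⁻¹) (Ici 1) μ) (z : ℂ) (hz : 0 ≤ z.re) (hz0 : z ≠ 0) :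
    DifferentiableAt ℂ (fun z : ℂ => ∫ x in Ici (0:ℝ), ((x:ℂ) + z)⁻¹ ∂μ) z := by
  have hr : 0 < ‖z‖ := norm_pos_iff.2 hz0
  have key : ∀ x : ℝ, 0 ≤ x → ∀ w ∈ Metric.ball z (‖z‖ / 2), max x ‖z‖ / 2 ≤ ‖(x:ℂ) + w‖ := by
    intro x hx w hw
    rw [Metric.mem_ball, dist_eq_norm] at hw
    have h1 := aux_norm_ge x hx z hz
    have h2 : ‖(x:ℂ) + z‖ ≤ ‖(x:ℂ) + w‖ + ‖w - z‖ := by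
      have : (x:ℂ) + z = ((x:ℂ) + w) - (w - z) := by ring
      rw [this]; exact norm_sub_le _ _
    have := le_max_right x ‖z‖
    linarith
  have h := hasDerivAt_integral_of_dominated_loc_of_deriv_le (μ := μ.restrict (Ici 0))
    (F := fun (w : ℂ) (x : ℝ) => ((x:ℂ) + w)⁻¹)
    (F' := fun (w : ℂ) (x : ℝ) => -1 / ((x:ℂ) + w) ^ 2)
    (bound := fun x : ℝ => (4 / ‖z‖ * (min 1 ‖z‖)⁻¹) * (max x 1)⁻¹)
    (Metric.ball_mem_nhds z (half_pos hr))
    (Eventually.of_forall fun w => aux_meas w _)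
    (aux_int_inv μ hμ01 hμint z hz hz0)
    (by apply Measurable.aestronglyMeasurable; fun_prop)
    (by
      filter_upwards [ae_restrict_mem measurableSet_Ici] with x hx w hw
      have h1 := key x hx w hw
      have h0 : 0 < min 1 ‖z‖ := lt_min one_pos hr
      have h3 : 0 < max x 1 := lt_of_lt_of_le one_pos (le_max_right _ _)
      have h4 := aux_max x _ hr
      have h5 := le_max_right x ‖z‖
      rw [norm_div, norm_neg, norm_one, norm_pow]
      have : 4 / ‖z‖ * (min 1 ‖z‖)⁻¹ * (max x 1)⁻¹ = 1 / (‖z‖ * (min 1 ‖z‖ * max x 1) / 4) := by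
        field_simp
      rw [this]
      apply one_div_le_one_div_of_le (by positivity)
      have h6 : (max x ‖z‖ / 2) ^ 2 ≤ ‖(x:ℂ) + w‖ ^ 2 :=
        pow_le_pow_left₀ (by linarith) h1 2
      have h7 : ‖z‖ * (min 1 ‖z‖ * max x 1) ≤ max x ‖z‖ * max x ‖z‖ :=
        mul_le_mul h5 h4 (by positivity) (by linarith)
      nlinarith)
    ((aux_integrable μ hμ01 hμint).const_mul _)
    (by
      filter_upwards [ae_restrict_mem measurableSet_Ici] with x hx w hw
      have h1 := key x hx w hw
      have h5 := le_max_right x ‖z‖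
      have hne : (x:ℂ) + w ≠ 0 := norm_pos_iff.1 (by linarith)
      exact ((hasDerivAt_id w).const_add (x:ℂ)).fun_inv hne)
  exact h.2.differentiableAt

lemma aux_contour (F : ℂ → ℂ) (m lam C : ℝ) (hm : 0 < m) (hlam : 0 < lam)
    (hdiff : ∀ z : ℂ, 0 ≤ z.re → z ≠ 0 → DifferentiableAt ℂ F z)
    (hre : ∀ z : ℂ, 0 ≤ z.re → z ≠ 0 → lam ≤ (F z).re)
    (hC : ∀ z : ℂ, 0 ≤ z.re → 1 ≤ ‖z‖ → ‖F z - m * z‖ ≤ C)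
    (hconj : ∀ z : ℂ, F (starRingEnd ℂ z) = starRingEnd ℂ (F z)) :
    ∫ ω in Ioi (0:ℝ), 2 * (F (ω * Complex.I)).re / Complex.normSq (F (ω * Complex.I))
      = Real.pi / m := by
  have hpi := Real.pi_pos
  have hF0 : ∀ z : ℂ, 0 ≤ z.re → z ≠ 0 → F z ≠ 0 := by
    intro z h1 h2 h
    have := hre z h1 h2
    rw [h] at this; simp at this; linarith
  have hFn : ∀ z : ℂ, 0 ≤ z.re → z ≠ 0 → lam ≤ ‖F z‖ := fun z h1 h2 =>
    (hre z h1 h2).trans (Complex.re_le_norm _)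
  set r : ℝ → ℝ := fun ω => 2 * (F (ω * Complex.I)).re / Complex.normSq (F (ω * Complex.I)) with hr
  set g : ℂ → ℂ := fun w => Complex.exp w / F (Complex.exp w) with hg
  set h : ℝ → ℝ := fun s => Real.exp s * r (Real.exp s) with hh
  have hexpre : ∀ s θ : ℝ, θ ∈ Icc (-(Real.pi / 2)) (Real.pi / 2) →
      0 ≤ (Complex.exp (s + θ * Complex.I)).re := by
    intro s θ hθ
    rw [Complex.exp_re]
    simp
    exact mul_nonneg (Real.exp_pos _).le (Real.cos_nonneg_of_mem_Icc hθ)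
  have hexpn : ∀ s θ : ℝ, ‖Complex.exp (s + θ * Complex.I)‖ = Real.exp s := by
    intro s θ; rw [Complex.norm_exp]; simp
  have hgd : ∀ s θ : ℝ, θ ∈ Icc (-(Real.pi / 2)) (Real.pi / 2) →
      DifferentiableAt ℂ g (s + θ * Complex.I) := by
    intro s θ hθ
    have h1 := hexpre s θ hθ
    refine DifferentiableAt.div (by fun_prop) ?_ (hF0 _ h1 (Complex.exp_ne_zero _))
    exact DifferentiableAt.comp (g := F) (f := Complex.exp) _ (hdiff _ h1 (Complex.exp_ne_zero _)) (by fun_prop)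
  have hgc : ∀ s : ℝ, ContinuousOn (fun θ : ℝ => g (s + θ * Complex.I)) (Icc (-(Real.pi / 2)) (Real.pi / 2)) := by
    intro s θ hθ
    apply ContinuousAt.continuousWithinAt
    exact ContinuousAt.comp (g := g) (f := fun θ : ℝ => (s:ℂ) + θ * Complex.I) (hgd s θ hθ).continuousAt (by fun_prop)
  have hgs : ∀ θ : ℝ, θ ∈ Icc (-(Real.pi / 2)) (Real.pi / 2) →
      Continuous (fun s : ℝ => g (s + θ * Complex.I)) := by
    intro θ hθ
    rw [continuous_iff_continuousAt]
    intro s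
    exact ContinuousAt.comp (g := g) (f := fun s : ℝ => (s:ℂ) + θ * Complex.I) (hgd s θ hθ).continuousAt (by fun_prop)
  have hmem1 : Real.pi / 2 ∈ Icc (-(Real.pi / 2)) (Real.pi / 2) := ⟨by linarith, le_rfl⟩
  have hmem2 : -(Real.pi / 2) ∈ Icc (-(Real.pi / 2)) (Real.pi / 2) := ⟨le_rfl, by linarith⟩
  have hiI : ∀ ω : ℝ, 0 < ω → (0 ≤ ((ω : ℂ) * Complex.I).re ∧ (ω : ℂ) * Complex.I ≠ 0) := by
    intro ω hω
    refine ⟨by simp, mul_ne_zero (by exact_mod_cast hω.ne') Complex.I_ne_zero⟩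
  have htb : ∀ s : ℝ, g (s + (Real.pi / 2 : ℝ) * Complex.I) - g (s + (-(Real.pi / 2) : ℝ) * Complex.I)
      = Complex.I * (h s : ℂ) := by
    intro s
    have e1 : Complex.exp (s + (Real.pi / 2 : ℝ) * Complex.I) = (Real.exp s : ℂ) * Complex.I := by
      rw [Complex.exp_add]; push_cast; rw [Complex.exp_pi_div_two_mul_I]
    have e2 : Complex.exp (s + (-(Real.pi / 2) : ℝ) * Complex.I)
        = starRingEnd ℂ ((Real.exp s : ℂ) * Complex.I) := by
      rw [← e1, ← Complex.exp_conj, map_add, map_mul, Complex.conj_ofReal, Complex.conj_ofReal, Complex.conj_I]; simp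
    have hne := hiI _ (Real.exp_pos s)
    have hz := hF0 _ hne.1 hne.2
    simp only [hg, hh, hr]
    rw [e1, e2, hconj]
    have hz' : starRingEnd ℂ (F ((Real.exp s : ℂ) * Complex.I)) ≠ 0 := by simpa using hz
    have e3 : ((2 * (F ((Real.exp s : ℂ) * Complex.I)).re : ℝ) : ℂ)
      = F ((Real.exp s : ℂ) * Complex.I) + starRingEnd ℂ (F ((Real.exp s : ℂ) * Complex.I)) := by
      rw [Complex.add_conj]
    rw [Complex.ofReal_mul, Complex.ofReal_div, e3, ← Complex.mul_conj]
    generalize F ((Real.exp s : ℂ) * Complex.I) = a at *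
    simp only [map_mul, Complex.conj_I, Complex.conj_ofReal]
    field_simp
    ring
  have hhc : Continuous h := by
    have : h = fun s : ℝ => ((g (s + (Real.pi / 2 : ℝ) * Complex.I) - g (s + (-(Real.pi / 2) : ℝ) * Complex.I)) / Complex.I).re := by
      ext s; rw [htb, mul_div_cancel_left₀ _ Complex.I_ne_zero, Complex.ofReal_re]
    rw [this]
    exact Complex.continuous_re.comp (((hgs _ hmem1).sub (hgs _ hmem2)).div_const _)
  have hh0 : ∀ s, 0 ≤ h s := by
    intro s
    have hne := hiI _ (Real.exp_pos s)
    have := hre _ hne.1 hne.2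
    exact mul_nonneg (Real.exp_pos s).le (div_nonneg (by linarith) (Complex.normSq_nonneg _))
  have hid : ∀ N : ℝ, ((∫ s in (-N)..N, h s : ℝ) : ℂ) =
      (∫ θ in (-(Real.pi / 2))..(Real.pi / 2), g (N + θ * Complex.I))
      - ∫ θ in (-(Real.pi / 2))..(Real.pi / 2), g ((-N : ℝ) + θ * Complex.I) := by
    intro N
    have H := Complex.integral_boundary_rect_eq_zero_of_differentiableOn g
      ⟨-N, -(Real.pi / 2)⟩ ⟨N, Real.pi / 2⟩ (by
        intro w hw
        rw [Complex.mem_reProdIm] at hw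
        have h2 := hw.2
        simp only at h2
        rw [uIcc_of_le (by linarith)] at h2
        have := hgd w.re w.im h2
        rw [Complex.re_add_im] at this
        exact this.differentiableWithinAt)
    simp only [smul_eq_mul] at H
    have H2 : (∫ s in (-N)..N, g (s + (Real.pi / 2 : ℝ) * Complex.I))
       - (∫ s in (-N)..N, g (s + (-(Real.pi / 2) : ℝ) * Complex.I)) = Complex.I * ((∫ s in (-N)..N, h s : ℝ) : ℂ) := by
      rw [← intervalIntegral.integral_sub ((hgs _ hmem1).intervalIntegrable _ _) ((hgs _ hmem2).intervalIntegrable _ _)]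
      rw [← intervalIntegral.integral_ofReal, ← intervalIntegral.integral_const_mul]
      exact intervalIntegral.integral_congr fun s _ => htb s
    apply mul_left_cancel₀ Complex.I_ne_zero
    rw [← H2]
    linear_combination -H
  have hlimL : Tendsto (fun N : ℝ => ∫ θ in (-(Real.pi / 2))..(Real.pi / 2), g ((-N : ℝ) + θ * Complex.I)) atTop (nhds 0) := by
    have hb : ∀ N : ℝ, ‖∫ θ in (-(Real.pi / 2))..(Real.pi / 2), g ((-N : ℝ) + θ * Complex.I)‖
        ≤ Real.exp (-N) / lam * |Real.pi / 2 - -(Real.pi / 2)| := by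
      intro N
      apply intervalIntegral.norm_integral_le_of_norm_le_const
      intro θ hθ
      rw [uIoc_of_le (by linarith)] at hθ
      simp only [hg]
      rw [norm_div, hexpn]
      exact div_le_div_of_nonneg_left (Real.exp_pos _).le hlam
        (hFn _ (hexpre _ _ ⟨hθ.1.le, hθ.2⟩) (Complex.exp_ne_zero _))
    refine squeeze_zero_norm hb ?_
    have := ((Real.tendsto_exp_neg_atTop_nhds_zero.div_const lam).mul_const |Real.pi / 2 - -(Real.pi / 2)|)
    simpa using this
  have hlimR : Tendsto (fun N : ℝ => ∫ θ in (-(Real.pi / 2))..(Real.pi / 2), g (N + θ * Complex.I)) atTop (nhds ((Real.pi / m : ℝ) : ℂ)) := by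
    rw [tendsto_iff_norm_sub_tendsto_zero]
    have hb : ∀ᶠ N : ℝ in atTop, ‖‖(∫ θ in (-(Real.pi / 2))..(Real.pi / 2), g (N + θ * Complex.I)) - ((Real.pi / m : ℝ) : ℂ)‖‖
        ≤ (2 * C / m ^ 2) * Real.exp (-N) * |Real.pi / 2 - -(Real.pi / 2)| := by
      filter_upwards [eventually_ge_atTop 0, Real.tendsto_exp_atTop.eventually_ge_atTop (2 * C / m)] with N hN0 hN
      have e : ((Real.pi / m : ℝ) : ℂ) = ∫ θ in (-(Real.pi / 2))..(Real.pi / 2), (1 / m : ℂ) := by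
        rw [intervalIntegral.integral_const]
        simp; ring
      rw [norm_norm, e, ← intervalIntegral.integral_sub
        (ContinuousOn.intervalIntegrable (by rw [uIcc_of_le (by linarith)]; exact hgc N)) (by simp)]
      apply intervalIntegral.norm_integral_le_of_norm_le_const
      intro θ hθ
      rw [uIoc_of_le (by linarith)] at hθ
      simp only [hg]
      have h1 := hexpre N θ ⟨hθ.1.le, hθ.2⟩
      have h2 := hexpn N θ
      have h3 := hF0 _ h1 (Complex.exp_ne_zero _)
      have hE := Real.exp_pos N
      have h4 := hC _ h1 (by rw [h2]; exact Real.one_le_exp hN0)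
      generalize Complex.exp (N + θ * Complex.I) = z at *
      have hmc : (m : ℂ) ≠ 0 := by exact_mod_cast hm.ne'
      have e5 : z / F z - 1 / m = -(F z - m * z) / (m * F z) := by
        field_simp; ring
      have h6 : m * Real.exp N / 2 ≤ ‖F z‖ := by
        have : ‖(m:ℂ) * z‖ ≤ ‖F z‖ + ‖F z - m * z‖ := by
          have : (m:ℂ) * z = F z - (F z - m * z) := by ring
          rw [this]
          refine (norm_sub_le _ _).trans (le_of_eq ?_)
          simp
        rw [norm_mul, h2, Complex.norm_real, Real.norm_of_nonneg hm.le] at this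
        rw [div_le_iff₀ hm] at hN
        linarith
      rw [e5, norm_div, norm_neg, norm_mul, Complex.norm_real, Real.norm_of_nonneg hm.le, Real.exp_neg]
      have hC0 : 0 ≤ C := (norm_nonneg _).trans h4
      have e7 : 2 * C / m ^ 2 * (Real.exp N)⁻¹ = C / (m * (m * Real.exp N / 2)) := by
        field_simp
      rw [e7]
      apply div_le_div₀ hC0 h4 (by positivity)
      exact mul_le_mul_of_nonneg_left h6 hm.le
    refine squeeze_zero_norm' hb ?_
    have := (Real.tendsto_exp_neg_atTop_nhds_zero.const_mul (2 * C / m ^ 2)).mul_const |Real.pi / 2 - -(Real.pi / 2)|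
    simpa using this
  have hlim : Tendsto (fun N : ℝ => ∫ s in (-N)..N, h s) atTop (nhds (Real.pi / m)) := by
    have h1 := hlimR.sub hlimL
    have h2 := (Complex.continuous_re.tendsto _).comp h1
    rw [sub_zero, Complex.ofReal_re] at h2
    refine h2.congr fun N => ?_
    simp only [Function.comp]
    rw [← hid, Complex.ofReal_re]
  have hint : Integrable h := by
    refine integrable_of_intervalIntegral_norm_tendsto (l := atTop) (a := fun N : ℝ => -N) (b := fun N : ℝ => N)
      (Real.pi / m) (fun N => hhc.integrableOn_Ioc) tendsto_neg_atTop_atBot tendsto_id ?_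
    refine hlim.congr fun N => ?_
    simp only [Real.norm_of_nonneg (hh0 _)]
  have hfin := tendsto_nhds_unique (intervalIntegral_tendsto_integral hint tendsto_neg_atTop_atBot tendsto_id) hlim
  have hsub := integral_image_eq_integral_abs_deriv_smul (s := univ) (f := Real.exp) (f' := Real.exp)
    MeasurableSet.univ (fun x _ => (Real.hasDerivAt_exp x).hasDerivWithinAt) Real.exp_injective.injOn r
  rw [image_univ, Real.range_exp] at hsub
  rw [hsub, ← hfin]
  simp [hh, abs_of_pos (Real.exp_pos _)]

theorem equipartition_free_particle_completely_monotonic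
    (μ : Measure ℝ) (m lam β : ℝ)
    (hm : 0 < m) (hlam : 0 < lam) (hβ : 0 < β)
    (hμ0 : μ {0} = 0)
    (hμ01 : μ (Icc (0:ℝ) 1) < ⊤)
    (hμint : IntegrableOn (fun x : ℝ => x⁻¹) (Ici 1) μ)
    (Kcos Ksin : ℝ → ℝ)
    (hKcos : ∀ ω > 0, Kcos ω = ∫ x in Ici (0:ℝ), x / (x ^ 2 + ω ^ 2) ∂μ)
    (hKsin : ∀ ω > 0, Ksin ω = ∫ x in Ici (0:ℝ), ω / (x ^ 2 + ω ^ 2) ∂μ) :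
    ∫ ω in Ioi (0:ℝ),
        2 * (lam + β * Kcos ω) /
          ((m * ω - β * Ksin ω) ^ 2 + (lam + β * Kcos ω) ^ 2)
      = Real.pi / m := by
  set K : ℂ → ℂ := fun z => ∫ x in Ici (0:ℝ), ((x:ℂ) + z)⁻¹ ∂μ with hK
  have hint := aux_int_inv μ hμ01 hμint
  have hKre : ∀ z : ℂ, 0 ≤ z.re → z ≠ 0 → (K z).re = ∫ x in Ici (0:ℝ), (((x:ℂ) + z)⁻¹).re ∂μ := by
    intro z h1 h2
    exact (integral_re (hint z h1 h2)).symm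
  have hKim : ∀ z : ℂ, 0 ≤ z.re → z ≠ 0 → (K z).im = ∫ x in Ici (0:ℝ), (((x:ℂ) + z)⁻¹).im ∂μ := by
    intro z h1 h2
    exact (integral_im (hint z h1 h2)).symm
  have hmain := aux_contour (fun z => m * z + lam + β * K z) m lam
    (lam + β * ∫ x in Ici (0:ℝ), (max x 1)⁻¹ ∂μ) hm hlam
    (by
      intro z h1 h2
      have := aux_diff μ hμ01 hμint z h1 h2
      exact DifferentiableAt.add (by fun_prop) (this.const_mul _))
    (by
      intro z h1 h2
      have : 0 ≤ (K z).re := by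
        rw [hKre z h1 h2]
        refine setIntegral_nonneg measurableSet_Ici fun x hx => ?_
        rw [Complex.inv_re]
        have hx' : 0 ≤ x := hx
        apply div_nonneg _ (Complex.normSq_nonneg _)
        simp; linarith
      simp
      have := mul_nonneg hβ.le this
      have := mul_nonneg hm.le h1
      linarith)
    (by
      intro z h1 h2
      have hz0 : z ≠ 0 := norm_pos_iff.1 (by linarith)
      have hb : ‖K z‖ ≤ ∫ x in Ici (0:ℝ), (max x 1)⁻¹ ∂μ := by
        refine norm_integral_le_of_norm_le (aux_integrable μ hμ01 hμint) ?_
        filter_upwards [ae_restrict_mem measurableSet_Ici] with x hx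
        have := aux_norm_inv x hx z h1 hz0
        rwa [min_eq_left h2, inv_one, one_mul] at this
      have e : (m * z + lam + β * K z) - m * z = lam + β * K z := by ring
      simp only [e]
      refine (norm_add_le _ _).trans ?_
      rw [norm_mul, Complex.norm_real, Complex.norm_real, Real.norm_of_nonneg hlam.le,
        Real.norm_of_nonneg hβ.le]
      have := mul_le_mul_of_nonneg_left hb hβ.le
      linarith)
    (by
      intro z
      have : K (starRingEnd ℂ z) = starRingEnd ℂ (K z) := by
        simp only [hK]
        rw [← integral_conj]
        simp
      simp [this])
  rw [← hmain]
  refine setIntegral_congr_fun measurableSet_Ioi fun ω hω => ?_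
  have hω' : 0 < ω := hω
  have h1 : 0 ≤ ((ω:ℂ) * Complex.I).re := by simp
  have h2 : (ω:ℂ) * Complex.I ≠ 0 := mul_ne_zero (by exact_mod_cast hω'.ne') Complex.I_ne_zero
  have ec : (K (ω * Complex.I)).re = Kcos ω := by
    rw [hKre _ h1 h2, hKcos ω hω']
    congr 1; ext x
    rw [Complex.inv_re, Complex.normSq_apply]
    simp [sq]
  have es : (K (ω * Complex.I)).im = -Ksin ω := by
    rw [hKim _ h1 h2, hKsin ω hω', ← integral_neg]
    congr 1; ext x
    rw [Complex.inv_im, Complex.normSq_apply]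
    simp [sq, neg_div]
  simp only [Complex.normSq_apply]
  simp [ec, es]
  congr 1
  ring
end

section
/- Let μ be a positive Borel measure on [0,∞) with μ({0}) = 0, μ([0,1]) < ∞ and ∫₁^∞ x^{−1/2} μ(dx) < ∞, and let m, λ, β > 0. For ω > 0 define 𝒦cos(ω) = (√π/2) ∫₀^∞ x^{−1/2} e^{−ω²/(4x)} μ(dx) and 𝒦sin(ω) = ∫₀^∞ x^{−1/2} daw(ω/(2√x)) μ(dx), where daw(y) = e^{−y²} ∫₀^y e^{s²} ds is Dawson's integral. Then ∫₀^∞ 2(λ + β·𝒦cos(ω)) / ((m·ω − β·𝒦sin(ω))² + (λ + β·𝒦cos(ω))²) dω = π/m. (This is the analytic content of equipartition of energy E[m v(0)²] = k_B T for the free-particle generalized Langevin equation with memory kernel K(t) = φ(t²), φ completely monotonic.) -/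
open MeasureTheory Filter Set

/-- Dawson's integral `daw(y) = e^{-y²} ∫₀^y e^{s²} ds`. -/
noncomputable def daw (y : ℝ) : ℝ :=
  Real.exp (-y ^ 2) * ∫ s in (0:ℝ)..y, Real.exp (s ^ 2)

/-- The Laplace transform of `t ↦ exp (-x t²)`. -/
noncomputable def Gk (x : ℝ) (z : ℂ) : ℂ :=
  ∫ t in Ioi (0:ℝ), Complex.exp (-(x * t ^ 2) - z * t)

noncomputable def Gk1 (x : ℝ) (z : ℂ) : ℂ :=
  ∫ t in Ioi (0:ℝ), -(t : ℂ) * Complex.exp (-(x * t ^ 2) - z * t)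

lemma norm_ker (x t : ℝ) (z : ℂ) :
    ‖Complex.exp (-(x * t ^ 2) - z * t)‖ = Real.exp (-(x * t ^ 2) - z.re * t) := by
  rw [Complex.norm_exp]
  congr 1
  have : (-((x:ℂ) * (t:ℂ) ^ 2) - z * t) = ((-(x * t ^ 2) : ℝ) : ℂ) - z * t := by push_cast; ring
  rw [this, Complex.sub_re, Complex.ofReal_re]
  simp

lemma integrable_ker {x : ℝ} (hx : 0 < x) (z : ℂ) :
    Integrable (fun t : ℝ => Complex.exp (-(x * t ^ 2) - z * t)) := by
  have := integrable_cexp_quadratic' (b := -(x:ℂ)) (by simpa using hx) (-z) 0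
  refine this.congr (Eventually.of_forall fun t => ?_)
  simp only
  congr 1
  ring

lemma integrable_rker {x : ℝ} (hx : 0 < x) (a : ℝ) :
    Integrable (fun t : ℝ => Real.exp (-(x * t ^ 2) - a * t)) := by
  refine (integrable_ker hx a).norm.congr (Eventually.of_forall fun t => ?_)
  simp only [norm_ker, Complex.ofReal_re]

lemma integrable_tker {x : ℝ} (hx : 0 < x) (z : ℂ) :
    IntegrableOn (fun t : ℝ => -(t:ℂ) * Complex.exp (-(x * t ^ 2) - z * t)) (Ioi 0) := by
  refine Integrable.mono' (integrable_rker hx (z.re - 1)).integrableOn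
    (Continuous.aestronglyMeasurable (by fun_prop)) ?_
  filter_upwards [self_mem_ae_restrict measurableSet_Ioi] with t ht
  have ht : 0 < t := ht
  rw [norm_mul, norm_ker, norm_neg, Complex.norm_real, Real.norm_of_nonneg ht.le]
  have : -(x * t ^ 2) - (z.re - 1) * t = t + (-(x * t ^ 2) - z.re * t) := by ring
  rw [this, Real.exp_add]
  gcongr
  linarith [Real.add_one_le_exp t]

lemma hasDerivAt_Gk {x : ℝ} (hx : 0 < x) (z : ℂ) : HasDerivAt (Gk x) (Gk1 x z) z := by
  refine (hasDerivAt_integral_of_dominated_loc_of_deriv_le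
    (μ := volume.restrict (Ioi (0:ℝ)))
    (F := fun z (t:ℝ) => Complex.exp (-(x * t ^ 2) - z * t))
    (F' := fun z (t:ℝ) => -(t : ℂ) * Complex.exp (-(x * t ^ 2) - z * t))
    (bound := fun t => Real.exp (-(x * t ^ 2) - (z.re - 2) * t))
    (s := Metric.ball z 1)
    (Metric.ball_mem_nhds z one_pos) ?_ ?_ ?_ ?_ ?_ ?_).2
  · exact Eventually.of_forall fun w => Continuous.aestronglyMeasurable (by fun_prop)
  · exact (integrable_ker hx z).integrableOn
  · exact Continuous.aestronglyMeasurable (by fun_prop)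
  · filter_upwards [self_mem_ae_restrict measurableSet_Ioi] with t ht w hw
    have ht : 0 < t := ht
    rw [norm_mul, norm_ker, norm_neg, Complex.norm_real, Real.norm_of_nonneg ht.le]
    have h1 : z.re - 1 ≤ w.re := by
      have := (Complex.abs_re_le_norm (w - z))
      rw [mem_ball_iff_norm] at hw
      have h2 := neg_abs_le (w - z).re
      simp only [Complex.sub_re] at *
      linarith
    have : -(x * t ^ 2) - (z.re - 2) * t = t + (-(x * t ^ 2) - (z.re - 1) * t) := by ring
    rw [this, Real.exp_add]
    gcongr
    linarith [Real.add_one_le_exp t]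
  · exact (integrable_rker hx _).integrableOn
  · refine Eventually.of_forall fun t w _ => ?_
    have h : HasDerivAt (fun z : ℂ => -((x:ℂ) * t ^ 2) - z * t) (-(t:ℂ)) w := by
      simpa using ((hasDerivAt_id w).mul_const (t:ℂ)).const_sub (-((x:ℂ) * t ^ 2))
    refine h.cexp.congr_deriv ?_
    ring

lemma Gk_ode {x : ℝ} (hx : 0 < x) {z : ℂ} (hz : 0 ≤ z.re) :
    z * Gk x z = 1 + 2 * x * Gk1 x z := by
  have key := integral_Ioi_of_hasDerivAt_of_tendsto' (a := 0) (m := (0:ℂ))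
    (f := fun t : ℝ => Complex.exp (-(x * t ^ 2) - z * t))
    (f' := fun t : ℝ => 2 * x * (-(t:ℂ) * Complex.exp (-(x * t ^ 2) - z * t))
      - z * Complex.exp (-(x * t ^ 2) - z * t)) ?_ ?_ ?_
  · rw [integral_sub ((integrable_tker hx z).const_mul _)
      ((integrable_ker hx z).integrableOn.const_mul _), integral_const_mul, integral_const_mul] at key
    simp only [Complex.ofReal_zero] at key
    norm_num at key
    unfold Gk Gk1
    simp only [neg_mul] at *
    linear_combination -key
  · intro t _
    have h0 : HasDerivAt (fun t : ℝ => (t:ℂ)) 1 t := Complex.ofRealCLM.hasDerivAt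
    have h : HasDerivAt (fun t : ℝ => -((x:ℂ) * (t:ℂ) ^ 2) - z * t) (-(x * (2 * t)) - z) t := by
      have h2 := (((h0.pow 2).const_mul (x:ℂ)).neg).sub (h0.const_mul z)
      refine h2.congr_deriv ?_
      simp
    refine h.cexp.congr_deriv ?_
    ring
  · exact ((integrable_tker hx z).const_mul _).sub
      ((integrable_ker hx z).integrableOn.const_mul _)
  · rw [tendsto_zero_iff_norm_tendsto_zero]
    simp only [norm_ker]
    have h1 : Tendsto (fun t : ℝ => Real.exp (-(x * t))) atTop (nhds 0) := by
      refine Real.tendsto_exp_neg_atTop_nhds_zero.comp (tendsto_id.const_mul_atTop hx)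
    refine squeeze_zero' (Eventually.of_forall fun t => (Real.exp_pos _).le) ?_ h1
    filter_upwards [eventually_ge_atTop 1] with t ht
    gcongr
    nlinarith [mul_nonneg hz (zero_le_one.trans ht), mul_nonneg hx.le (mul_nonneg (zero_le_one.trans ht) (sub_nonneg.2 ht))]

lemma norm_Gk_le {x : ℝ} (hx : 0 < x) {z : ℂ} (hz : 0 ≤ z.re) : ‖Gk x z‖ ≤ 1 / Real.sqrt x := by
  have h1 : ‖Gk x z‖ ≤ ∫ t in Ioi (0:ℝ), Real.exp (-x * t ^ 2) := by
    refine norm_integral_le_of_norm_le ?_ ?_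
    · have := (integrable_rker hx 0).integrableOn (s := Ioi 0)
      rw [IntegrableOn] at this
      simpa using this
    · filter_upwards [self_mem_ae_restrict measurableSet_Ioi] with t ht
      have ht : 0 < t := ht
      rw [norm_ker]
      gcongr
      nlinarith [mul_nonneg hz ht.le]
  refine h1.trans ?_
  rw [integral_gaussian_Ioi, Real.sqrt_div Real.pi_pos.le, div_right_comm]
  gcongr
  rw [div_le_one two_pos, Real.sqrt_le_left two_pos.le]
  linarith [Real.pi_le_four]

lemma norm_Gk1_le {x : ℝ} (hx : 0 < x) {z : ℂ} (hz : 0 ≤ z.re) : ‖Gk1 x z‖ ≤ 1 / (2 * x) := by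
  have e : ∀ r : ℝ, (r : ℂ) * Complex.exp (-(x:ℂ) * (r : ℂ) ^ 2) =
      ((r * Real.exp (-x * r ^ 2) : ℝ) : ℂ) := by intro r; push_cast; rfl
  have h2 : ∫ t in Ioi (0:ℝ), t * Real.exp (-x * t ^ 2) = 1 / (2 * x) := by
    have := integral_mul_cexp_neg_mul_sq (b := (x:ℂ)) (by simpa using hx)
    simp only [e] at this
    rw [integral_complex_ofReal] at this
    rw [one_div]
    exact_mod_cast this
  rw [← h2]
  refine norm_integral_le_of_norm_le ?_ ?_
  · have := integrable_mul_cexp_neg_mul_sq (b := (x:ℂ)) (by simpa using hx)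
    simp only [e] at this
    exact (this.re.congr (Eventually.of_forall fun t => by
      simp only [RCLike.re_eq_complex_re, Complex.ofReal_re])).integrableOn
  · filter_upwards [self_mem_ae_restrict measurableSet_Ioi] with t ht
    have ht : 0 < t := ht
    rw [norm_mul, norm_ker, norm_neg, Complex.norm_real, Real.norm_of_nonneg ht.le]
    gcongr
    nlinarith [mul_nonneg hz ht.le]

lemma norm_Gk_le' {x : ℝ} (hx : 0 < x) {z : ℂ} (hz : 0 ≤ z.re) (hz0 : z ≠ 0) :
    ‖Gk x z‖ ≤ 2 / ‖z‖ := by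
  have h0 : 0 < ‖z‖ := norm_pos_iff.2 hz0
  rw [le_div_iff₀ h0, mul_comm, ← norm_mul, Gk_ode hx hz]
  refine (norm_add_le _ _).trans ?_
  have := norm_Gk1_le hx hz
  have h2 : ‖(2 * x * Gk1 x z : ℂ)‖ = 2 * x * ‖Gk1 x z‖ := by
    simp [abs_of_pos hx]
  rw [h2, norm_one]
  have : 2 * x * ‖Gk1 x z‖ ≤ 2 * x * (1 / (2 * x)) := by gcongr
  have h3 : 2 * x * (1 / (2 * x)) = 1 := by field_simp
  linarith

lemma integrable_texp {c : ℝ} (hc : 0 < c) :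
    IntegrableOn (fun t : ℝ => t * Real.exp (-c * t)) (Ioi 0) := by
  have := integrableOn_rpow_mul_exp_neg_mul_rpow (p := 1) (s := 1) (b := c) (by norm_num) one_pos hc
  simpa using this

lemma norm_Gk1_le' {x : ℝ} (hx : 0 < x) {c : ℝ} (hc : 0 < c) {z : ℂ} (hz : c ≤ z.re) :
    ‖Gk1 x z‖ ≤ ∫ t in Ioi (0:ℝ), t * Real.exp (-c * t) := by
  refine norm_integral_le_of_norm_le (integrable_texp hc) ?_
  filter_upwards [self_mem_ae_restrict measurableSet_Ioi] with t ht
  have ht : 0 < t := ht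
  rw [norm_mul, norm_ker, norm_neg, Complex.norm_real, Real.norm_of_nonneg ht.le]
  gcongr
  nlinarith [mul_nonneg (sub_nonneg.2 hz) ht.le, mul_nonneg hx.le (sq_nonneg t)]

lemma Gk_conj (x : ℝ) (z : ℂ) : Gk x (starRingEnd ℂ z) = starRingEnd ℂ (Gk x z) := by
  unfold Gk
  rw [← integral_conj]
  congr 1
  ext t
  rw [← Complex.exp_conj]
  simp

lemma Gk_zero (x : ℝ) : Gk x 0 = ((Real.sqrt Real.pi / 2 * (1 / Real.sqrt x) : ℝ) : ℂ) := by
  have := integral_gaussian_Ioi x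
  unfold Gk
  have e : ∀ t : ℝ, Complex.exp (-(x * t ^ 2) - 0 * t) = ((Real.exp (-x * t ^ 2) : ℝ) : ℂ) := by
    intro t; push_cast; congr 1; ring
  simp only [e]
  rw [integral_complex_ofReal, this, Real.sqrt_div Real.pi_pos.le]
  congr 1
  ring

lemma Gk_imag {x : ℝ} (hx : 0 < x) (ω : ℝ) :
    Gk x (Complex.I * ω) =
      ((Real.sqrt Real.pi / 2 * ((1 / Real.sqrt x) * Real.exp (-(ω ^ 2 / (4 * x)))) : ℝ) : ℂ)
      - Complex.I * (((1 / Real.sqrt x) * daw (ω / (2 * Real.sqrt x)) : ℝ) : ℂ) := by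
  have hs : 0 < Real.sqrt x := Real.sqrt_pos.2 hx
  have hss : Real.sqrt x ^ 2 = x := Real.sq_sqrt hx.le
  have hsc : ((Real.sqrt x : ℝ) : ℂ) ≠ 0 := by exact_mod_cast hs.ne'
  have hssc : ((Real.sqrt x : ℝ) : ℂ) ^ 2 = x := by exact_mod_cast hss
  have hxc : (x : ℂ) ≠ 0 := by exact_mod_cast hx.ne'
  set P : ℝ → ℂ := fun ω => ((Real.exp (ω ^ 2 / (4 * x)) : ℝ) : ℂ) * Gk x (Complex.I * ω) +
    Complex.I * (((1 / Real.sqrt x) *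
      ∫ s in (0:ℝ)..(ω / (2 * Real.sqrt x)), Real.exp (s ^ 2) : ℝ) : ℂ) with hP
  have hd : ∀ ω, HasDerivAt P 0 ω := by
    intro ω
    have h1 : HasDerivAt (fun ω : ℝ => Real.exp (ω ^ 2 / (4 * x)))
        (Real.exp (ω ^ 2 / (4 * x)) * (2 * ω / (4 * x))) ω := by
      have := ((hasDerivAt_pow 2 ω).div_const (4 * x)).exp
      simpa using this
    have h0 : HasDerivAt (fun t : ℝ => Complex.I * (t:ℂ)) Complex.I ω := by
      simpa using (Complex.ofRealCLM.hasDerivAt (x := ω)).const_mul Complex.I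
    have h2 : HasDerivAt (fun ω : ℝ => Gk x (Complex.I * ω)) (Gk1 x (Complex.I * ω) * Complex.I) ω :=
      HasDerivAt.comp ω (h₂ := Gk x) (hasDerivAt_Gk hx (Complex.I * ω)) h0
    have h3 : HasDerivAt (fun u : ℝ => ∫ s in (0:ℝ)..u, Real.exp (s ^ 2))
        (Real.exp ((ω / (2 * Real.sqrt x)) ^ 2)) (ω / (2 * Real.sqrt x)) :=
      (Continuous.integral_hasStrictDerivAt (by fun_prop) 0 _).hasDerivAt
    have h4 := (h3.comp ω ((hasDerivAt_id ω).div_const (2 * Real.sqrt x))).const_mul (1 / Real.sqrt x)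
    have h5 := (h1.ofReal_comp.mul h2).add (h4.ofReal_comp.const_mul Complex.I)
    refine h5.congr_deriv ?_
    have ode := Gk_ode hx (z := Complex.I * ω) (by simp)
    have e1 : (ω / (2 * Real.sqrt x)) ^ 2 = ω ^ 2 / (4 * x) := by
      rw [div_pow, mul_pow, hss]; norm_num
    rw [e1]
    have e2 : Gk1 x (Complex.I * ω) = (Complex.I * ω * Gk x (Complex.I * ω) - 1) / (2 * x) := by
      rw [ode]; field_simp; ring
    rw [e2]
    push_cast
    rw [← hssc]
    field_simp
    ring_nf
    simp only [Complex.I_sq]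
    ring
  have hconst : P ω = P 0 := is_const_of_deriv_eq_zero (fun w => (hd w).differentiableAt)
    (fun w => (hd w).deriv) ω 0
  have hP0 : P 0 = ((Real.sqrt Real.pi / 2 * (1 / Real.sqrt x) : ℝ) : ℂ) := by
    simp only [hP]
    simp only [Complex.ofReal_zero, mul_zero, Gk_zero]
    simp
  rw [hP0] at hconst
  simp only [hP] at hconst
  have he : Real.exp (-(ω / (2 * Real.sqrt x)) ^ 2) = Real.exp (-(ω ^ 2 / (4 * x))) := by
    congr 2; rw [div_pow, mul_pow, hss]; norm_num
  have hee : (Real.exp (-(ω ^ 2 / (4 * x))) : ℂ) * (Real.exp (ω ^ 2 / (4 * x)) : ℂ) = 1 := by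
    rw [← Complex.ofReal_mul, ← Real.exp_add]; simp
  unfold daw
  rw [he]
  simp only [Complex.ofReal_mul] at *
  linear_combination (Real.exp (-(ω ^ 2 / (4 * x))) : ℂ) * hconst - (Gk x (Complex.I * ω)) * hee

lemma continuous_Gk {x : ℝ} (hx : 0 < x) : Continuous (Gk x) :=
  continuous_iff_continuousAt.2 fun z => (hasDerivAt_Gk hx z).continuousAt

lemma Gk_re_nonneg {x : ℝ} (hx : 0 < x) {z : ℂ} (hz : 0 ≤ z.re) : 0 ≤ (Gk x z).re := by
  have key : ‖Complex.exp (-(Gk x z))‖ ≤ 1 := by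
    have hbd : ∀ w : ℂ, 0 ≤ w.re → ‖Complex.exp (-(Gk x w))‖ ≤ Real.exp (1 / Real.sqrt x) := by
      intro w hw
      rw [Complex.norm_exp]
      gcongr
      refine (Complex.re_le_norm _).trans ?_
      rw [norm_neg]
      exact norm_Gk_le hx hw
    refine PhragmenLindelof.right_half_plane_of_bounded_on_real
      (f := fun z => Complex.exp (-(Gk x z))) ?_ ⟨1, by norm_num, 0, ?_⟩ ?_ ?_ hz
    · refine Differentiable.diffContOnCl ?_
      intro w
      exact (hasDerivAt_Gk hx w).differentiableAt.neg.cexp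
    · refine Asymptotics.IsBigO.of_bound (Real.exp (1 / Real.sqrt x)) ?_
      refine Filter.mem_inf_of_right ?_
      intro w hw
      have hw : 0 < w.re := hw
      simpa using hbd w hw.le
    · refine ⟨Real.exp (1 / Real.sqrt x), ?_⟩
      rw [eventually_map]
      filter_upwards [eventually_ge_atTop 0] with t ht
      exact hbd _ (by simpa using ht)
    · intro t
      rw [mul_comm, Gk_imag hx, Complex.norm_exp, Real.exp_le_one_iff]
      rw [Complex.neg_re, Complex.sub_re, Complex.I_mul_re, Complex.ofReal_re, Complex.ofReal_im]
      simp only [neg_zero, sub_zero, neg_nonpos]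
      positivity
  rw [Complex.norm_exp, Real.exp_le_one_iff] at key
  simpa using key

lemma cayley_re_pos {w : ℂ} (hw : ‖w‖ < 1) : 0 < ((1 - w) / (1 + w)).re := by
  have h1 : Complex.normSq w < 1 := by
    rw [Complex.normSq_eq_norm_sq]
    nlinarith [norm_nonneg w]
  have h2 : 1 + w ≠ 0 := by
    intro h
    have : w = -1 := by linear_combination h
    rw [this] at hw
    simp at hw
  have h3 : 0 < Complex.normSq (1 + w) := Complex.normSq_pos.2 h2
  rw [Complex.div_re, ← add_div]
  apply div_pos _ h3
  simp only [Complex.normSq_apply] at h1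
  simp
  nlinarith

lemma one_add_ne {w : ℂ} (hw : ‖w‖ < 1) : 1 + w ≠ 0 := by
  intro h
  have : w = -1 := by linear_combination h
  rw [this] at hw
  simp at hw

lemma cayley_arctan (ω : ℝ) : Complex.exp ((2 * Real.arctan ω : ℝ) * Complex.I) =
    (1 + Complex.I * ω) / (1 - Complex.I * ω) := by
  have hpos : 0 < 1 + ω ^ 2 := by positivity
  have hs : 0 < Real.sqrt (1 + ω ^ 2) := Real.sqrt_pos.2 hpos
  have hss : Real.sqrt (1 + ω ^ 2) ^ 2 = 1 + ω ^ 2 := Real.sq_sqrt hpos.le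
  have hne : (1 - Complex.I * ω) ≠ 0 := by
    intro h
    have := congrArg Complex.re h
    simp at this
  have e : Complex.exp ((Real.arctan ω : ℝ) * Complex.I) =
      (1 + Complex.I * ω) / (Real.sqrt (1 + ω ^ 2) : ℝ) := by
    rw [Complex.exp_mul_I, ← Complex.ofReal_cos, ← Complex.ofReal_sin, Real.cos_arctan,
      Real.sin_arctan]
    push_cast
    ring
  have e2 : (((2 * Real.arctan ω : ℝ) : ℂ) * Complex.I) =
      (2:ℕ) * ((Real.arctan ω : ℝ) * Complex.I) := by push_cast; ring
  rw [e2, Complex.exp_nat_mul, e, div_pow, ← Complex.ofReal_pow, hss]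
  rw [div_eq_div_iff (by exact_mod_cast hpos.ne') hne]
  push_cast
  linear_combination (-(ω:ℂ) ^ 2 * (1 + Complex.I * ω)) * Complex.I_sq

lemma image_arctan : (fun ω : ℝ => 2 * Real.arctan ω) '' univ = Ioo (-Real.pi) Real.pi := by
  ext t
  constructor
  · rintro ⟨ω, -, rfl⟩
    have h1 := Real.neg_pi_div_two_lt_arctan ω
    have h2 := Real.arctan_lt_pi_div_two ω
    constructor <;> simp only <;> linarith
  · rintro ⟨h1, h2⟩
    refine ⟨Real.tan (t / 2), mem_univ _, ?_⟩
    simp only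
    rw [Real.arctan_tan (by linarith) (by linarith)]
    ring

lemma poisson (h : ℂ → ℂ) (C : ℝ) (hd : ∀ z : ℂ, 0 < z.re → DifferentiableAt ℂ h z)
    (hb : ∀ z : ℂ, 0 < z.re → ‖h z‖ ≤ C)
    (hc : ∀ ω : ℝ, ω ≠ 0 → Tendsto h (nhdsWithin (-(Complex.I * ω)) {z | 0 < z.re})
      (nhds (h (-(Complex.I * ω))))) :
    ∫ ω : ℝ, (2 / (1 + ω ^ 2)) • h (-(Complex.I * ω)) = 2 * Real.pi * h 1 := by
  set g : ℂ → ℂ := fun w => h ((1 - w) / (1 + w)) with hg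
  -- change of variables
  have hcov : ∫ t in Ioo (-Real.pi) Real.pi, g (Complex.exp (t * Complex.I)) =
      ∫ ω : ℝ, (2 / (1 + ω ^ 2)) • h (-(Complex.I * ω)) := by
    rw [← image_arctan, integral_image_eq_integral_abs_deriv_smul (f' := fun ω => 2 * (1 / (1 + ω ^ 2)))
      MeasurableSet.univ]
    · rw [Measure.restrict_univ]
      congr 1
      ext ω
      rw [cayley_arctan, abs_of_pos (by positivity)]
      have hne : (1 - Complex.I * ω) ≠ 0 := by
        intro h
        have := congrArg Complex.re h
        simp at this
      have : (1 - (1 + Complex.I * ω) / (1 - Complex.I * ω)) / (1 + (1 + Complex.I * ω) / (1 - Complex.I * ω))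
          = -(Complex.I * ω) := by
        have h1 : 1 - (1 + Complex.I * ω) / (1 - Complex.I * ω) = (-2 * (Complex.I * ω)) / (1 - Complex.I * ω) := by
          field_simp; ring
        have h2 : 1 + (1 + Complex.I * ω) / (1 - Complex.I * ω) = 2 / (1 - Complex.I * ω) := by
          field_simp; ring
        rw [h1, h2, div_div_div_cancel_right₀ hne]
        ring
      simp only [hg]
      rw [this]
      congr 1
      ring
    · intro ω _
      exact ((Real.hasDerivAt_arctan ω).const_mul 2).hasDerivWithinAt
    · intro a _ b _ hab
      exact Real.arctan_injective (by simpa using hab)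
  rw [← hcov]
  -- mean value property on smaller circles
  set r : ℕ → ℝ := fun n => 1 - 1 / ((n:ℝ) + 2) with hr
  have hr0 : ∀ n, 0 < r n := by
    intro n
    have : 1 / ((n:ℝ) + 2) < 1 := by
      rw [div_lt_one (by positivity)]
      have : (0:ℝ) ≤ n := n.cast_nonneg
      linarith
    simp only [hr]; linarith
  have hr1 : ∀ n, r n < 1 := by
    intro n
    have : 0 < 1 / ((n:ℝ) + 2) := by positivity
    simp only [hr]; linarith
  have hrt : Tendsto r atTop (nhds 1) := by
    have h1 : Tendsto (fun n : ℕ => 1 / ((n:ℝ) + 2)) atTop (nhds 0) := by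
      have := (tendsto_const_nhds (x := (1:ℝ))).div_atTop
        (tendsto_atTop_add_const_right _ (2:ℝ) tendsto_natCast_atTop_atTop)
      exact this
    simpa [hr] using h1.const_sub 1
  have hgd : ∀ w : ℂ, ‖w‖ < 1 → DifferentiableAt ℂ g w := by
    intro w hw
    refine DifferentiableAt.comp w (g := h) (hd _ (cayley_re_pos hw)) ?_
    refine DifferentiableAt.div ?_ ?_ (one_add_ne hw) <;> fun_prop
  have hnorm : ∀ n (t : ℝ), ‖(r n : ℂ) * Complex.exp (t * Complex.I)‖ < 1 := by
    intro n t
    rw [norm_mul, Complex.norm_exp_ofReal_mul_I, mul_one, Complex.norm_real,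
      Real.norm_of_nonneg (hr0 n).le]
    exact hr1 n
  have hmv : ∀ n, ∫ t in Ioo (-Real.pi) Real.pi, g (r n * Complex.exp (t * Complex.I)) =
      2 * Real.pi * h 1 := by
    intro n
    have h1 : Real.circleAverage g 0 (r n) = g 0 := by
      refine circleAverage_of_differentiable_on_off_countable countable_empty ?_ ?_
      · intro w hw
        refine (hgd w ?_).continuousAt.continuousWithinAt
        rw [mem_closedBall_zero_iff, abs_of_pos (hr0 n)] at hw
        exact hw.trans_lt (hr1 n)
      · intro w hw
        refine hgd w ?_
        have := hw.1
        rw [mem_ball_zero_iff, abs_of_pos (hr0 n)] at this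
        exact this.trans (hr1 n)
    have hg0 : g 0 = h 1 := by simp [hg]
    rw [Real.circleAverage, hg0] at h1
    have hper : Function.Periodic (fun t => g (circleMap 0 (r n) t)) (2 * Real.pi) := by
      intro t
      simp only [periodic_circleMap 0 (r n) t]
    have h2 := hper.intervalIntegral_add_eq 0 (-Real.pi)
    rw [zero_add, show -Real.pi + 2 * Real.pi = Real.pi by ring] at h2
    rw [h2, intervalIntegral.integral_of_le (by linarith [Real.pi_pos]),
      integral_Ioc_eq_integral_Ioo] at h1
    simp only [circleMap, zero_add] at h1
    have hp : (Real.pi : ℂ) ≠ 0 := by exact_mod_cast Real.pi_ne_zero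
    rw [← h1, Complex.real_smul]
    push_cast
    rw [mul_inv_cancel_left₀ (mul_ne_zero two_ne_zero hp)]
  refine tendsto_nhds_unique (f := fun n => ∫ t in Ioo (-Real.pi) Real.pi, g (r n * Complex.exp (t * Complex.I)))
    (l := atTop) ?_ (by simp only [hmv]; exact tendsto_const_nhds)
  refine tendsto_integral_of_dominated_convergence (fun _ => C) ?_ ?_ ?_ ?_
  · intro n
    refine Continuous.aestronglyMeasurable ?_
    rw [continuous_iff_continuousAt]
    intro t
    refine ContinuousAt.comp (g := g) (hgd _ (hnorm n t)).continuousAt ?_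
    fun_prop
  · exact integrableOn_const (by simp)
  · intro n
    exact Eventually.of_forall fun t => hb _ (cayley_re_pos (hnorm n t))
  · have h0 : ∀ᵐ t : ℝ ∂(volume.restrict (Ioo (-Real.pi) Real.pi)), t ≠ 0 := by
      refine ae_restrict_of_ae ?_
      exact Measure.ae_ne volume 0
    filter_upwards [h0, self_mem_ae_restrict measurableSet_Ioo] with t ht0 ht
    rw [← image_arctan] at ht
    obtain ⟨ω, -, hω⟩ := ht
    simp only at hω
    have hω0 : ω ≠ 0 := by
      rintro rfl
      simp at hω
      exact ht0 hω.symm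
    have hne : (1 - Complex.I * ω) ≠ 0 := by
      intro h
      have := congrArg Complex.re h
      simp at this
    have h2 : 1 + (1 + Complex.I * ω) / (1 - Complex.I * ω) = 2 / (1 - Complex.I * ω) := by
      field_simp; ring
    have hM : (1 - Complex.exp (t * Complex.I)) / (1 + Complex.exp (t * Complex.I))
          = -(Complex.I * ω) := by
      rw [← hω, cayley_arctan]
      have h1 : 1 - (1 + Complex.I * ω) / (1 - Complex.I * ω) = (-2 * (Complex.I * ω)) / (1 - Complex.I * ω) := by
        field_simp; ring
      rw [h1, h2, div_div_div_cancel_right₀ hne]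
      ring
    have hne2 : 1 + Complex.exp (t * Complex.I) ≠ 0 := by
      rw [← hω, cayley_arctan, h2]
      exact div_ne_zero two_ne_zero hne
    have hlim : Tendsto (fun n => (1 - r n * Complex.exp (t * Complex.I)) / (1 + r n * Complex.exp (t * Complex.I)))
        atTop (nhds (-(Complex.I * ω))) := by
      rw [← hM]
      have hrc : Tendsto (fun n => (r n : ℂ) * Complex.exp (t * Complex.I)) atTop
          (nhds (Complex.exp (t * Complex.I))) := by
        have := ((Complex.continuous_ofReal.tendsto 1).comp hrt).mul_const (Complex.exp (t * Complex.I))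
        simpa using this
      exact (hrc.const_sub 1).div (hrc.const_add 1) hne2
    simp only [hg]
    rw [hM]
    refine (hc ω hω0).comp (tendsto_nhdsWithin_iff.2 ⟨hlim, ?_⟩)
    exact Eventually.of_forall fun n => cayley_re_pos (hnorm n t)

noncomputable def bb (x : ℝ) : ℝ :=
  (Icc (0:ℝ) 1).indicator (fun _ => (2:ℝ)) x + (Ici (1:ℝ)).indicator (fun x => 1 / Real.sqrt x) x

lemma bb_nonneg (x : ℝ) : 0 ≤ bb x :=
  add_nonneg (indicator_nonneg (fun _ _ => two_pos.le) _)
    (indicator_nonneg (fun _ _ => by positivity) _)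

lemma bb_low {x : ℝ} (h0 : 0 < x) (h1 : x ≤ 1) : 2 ≤ bb x := by
  unfold bb
  rw [indicator_of_mem (show x ∈ Icc (0:ℝ) 1 from ⟨h0.le, h1⟩)]
  have : 0 ≤ (Ici (1:ℝ)).indicator (fun x => 1 / Real.sqrt x) x :=
    indicator_nonneg (fun _ _ => by positivity) _
  linarith

lemma bb_high {x : ℝ} (h1 : 1 ≤ x) : 1 / Real.sqrt x ≤ bb x := by
  unfold bb
  rw [indicator_of_mem (show x ∈ Ici (1:ℝ) from h1)]
  have : 0 ≤ (Icc (0:ℝ) 1).indicator (fun _ => (2:ℝ)) x :=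
    indicator_nonneg (fun _ _ => two_pos.le) _
  linarith

lemma bb_integrable {μ : Measure ℝ} (hμ01 : μ (Icc (0:ℝ) 1) < ⊤)
    (hμint : IntegrableOn (fun x : ℝ => 1 / Real.sqrt x) (Ici 1) μ) : Integrable bb μ := by
  refine Integrable.add ?_ ?_
  · rw [integrable_indicator_iff measurableSet_Icc]
    exact integrableOn_const hμ01.ne
  · rw [integrable_indicator_iff measurableSet_Ici]
    exact hμint

lemma Gk_le_bb {x : ℝ} (hx : 0 < x) {z : ℂ} (hz : 0 ≤ z.re) (hz0 : z ≠ 0) :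
    ‖Gk x z‖ ≤ (1 + 1 / ‖z‖) * bb x := by
  have hp : 0 ≤ 1 / ‖z‖ := by positivity
  rcases le_total x 1 with h | h
  · have h1 := norm_Gk_le' hx hz hz0
    have h2 := bb_low hx h
    have h3 : 2 / ‖z‖ = 1 / ‖z‖ * 2 := by ring
    nlinarith [mul_le_mul_of_nonneg_left h2 hp]
  · have h1 := norm_Gk_le hx hz
    have h2 := bb_high h
    nlinarith [mul_nonneg hp (bb_nonneg x)]

lemma Gk1_le_bb {x : ℝ} (hx : 0 < x) {c : ℝ} (hc : 0 < c) {z : ℂ} (hz : c ≤ z.re) :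
    ‖Gk1 x z‖ ≤ (1 + ∫ t in Ioi (0:ℝ), t * Real.exp (-c * t)) * bb x := by
  have hp : 0 ≤ ∫ t in Ioi (0:ℝ), t * Real.exp (-c * t) :=
    setIntegral_nonneg measurableSet_Ioi fun t ht => mul_nonneg (le_of_lt ht) (Real.exp_pos _).le
  rcases le_total x 1 with h | h
  · have h1 := norm_Gk1_le' hx hc hz
    have h2 := bb_low hx h
    nlinarith [mul_le_mul_of_nonneg_left h2 hp]
  · have h1 := norm_Gk1_le hx (hc.le.trans hz)
    have h2 := bb_high h
    have h3 : 1 / (2 * x) ≤ 1 / Real.sqrt x := by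
      have : 0 < Real.sqrt x := Real.sqrt_pos.2 hx
      have h4 : Real.sqrt x ≤ x := by
        rw [Real.sqrt_le_left hx.le]; nlinarith
      gcongr
      linarith
    nlinarith [mul_nonneg hp (bb_nonneg x)]

lemma Gk_meas (z : ℂ) : StronglyMeasurable (fun x => Gk x z) := by
  refine StronglyMeasurable.integral_prod_right
    (f := fun (x t : ℝ) => Complex.exp (-(x * t ^ 2) - z * t)) ?_
  refine Continuous.stronglyMeasurable ?_
  unfold Function.uncurry
  fun_prop

lemma Gk1_meas (z : ℂ) : StronglyMeasurable (fun x => Gk1 x z) := by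
  refine StronglyMeasurable.integral_prod_right
    (f := fun (x t : ℝ) => -(t:ℂ) * Complex.exp (-(x * t ^ 2) - z * t)) ?_
  refine Continuous.stronglyMeasurable ?_
  unfold Function.uncurry
  fun_prop

/-- Laplace transform of the memory kernel. -/
noncomputable def Kh (μ : Measure ℝ) (z : ℂ) : ℂ := ∫ x in Ioi (0:ℝ), Gk x z ∂μ

section
variable {μ : Measure ℝ}

lemma Gk_int (hμ : Integrable bb μ) {z : ℂ} (hz : 0 ≤ z.re) (hz0 : z ≠ 0) :
    IntegrableOn (fun x => Gk x z) (Ioi 0) μ := by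
  refine Integrable.mono' (hμ.integrableOn.const_mul (1 + 1 / ‖z‖))
    (Gk_meas z).aestronglyMeasurable ?_
  filter_upwards [self_mem_ae_restrict measurableSet_Ioi] with x hx
  exact Gk_le_bb hx hz hz0

lemma Kh_re_nonneg (hμ : Integrable bb μ) {z : ℂ} (hz : 0 ≤ z.re) (hz0 : z ≠ 0) :
    0 ≤ (Kh μ z).re := by
  unfold Kh
  have := integral_re (𝕜 := ℂ) (Gk_int hμ hz hz0)
  simp only [RCLike.re_eq_complex_re] at this
  rw [← this]
  exact setIntegral_nonneg measurableSet_Ioi fun x hx => Gk_re_nonneg hx hz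

lemma Kh_norm (hμ : Integrable bb μ) {z : ℂ} (hz : 0 ≤ z.re) (hz0 : z ≠ 0) :
    ‖Kh μ z‖ ≤ (1 + 1 / ‖z‖) * ∫ x in Ioi (0:ℝ), bb x ∂μ := by
  unfold Kh
  rw [← integral_const_mul]
  refine norm_integral_le_of_norm_le (hμ.integrableOn.const_mul (1 + 1 / ‖z‖)) ?_
  filter_upwards [self_mem_ae_restrict measurableSet_Ioi] with x hx
  exact Gk_le_bb hx hz hz0

lemma Kh_diff (hμ : Integrable bb μ) {z : ℂ} (hz : 0 < z.re) : DifferentiableAt ℂ (Kh μ) z := by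
  have hz2 : 0 < z.re / 2 := by linarith
  have hz0 : z ≠ 0 := by rintro rfl; simp at hz
  refine (hasDerivAt_integral_of_dominated_loc_of_deriv_le
    (μ := μ.restrict (Ioi (0:ℝ)))
    (F := fun z x => Gk x z)
    (F' := fun z x => Gk1 x z)
    (bound := fun x => (1 + ∫ t in Ioi (0:ℝ), t * Real.exp (-(z.re / 2) * t)) * bb x)
    (s := {w : ℂ | z.re / 2 < w.re}) ?_ ?_ ?_ ?_ ?_ ?_ ?_).2.differentiableAt
  · exact (isOpen_lt continuous_const Complex.continuous_re).mem_nhds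
      (show z.re / 2 < z.re by linarith)
  · exact Eventually.of_forall fun w => (Gk_meas w).aestronglyMeasurable
  · exact Gk_int hμ hz.le hz0
  · exact (Gk1_meas z).aestronglyMeasurable
  · filter_upwards [self_mem_ae_restrict measurableSet_Ioi] with x hx w hw
    exact Gk1_le_bb hx hz2 (le_of_lt hw)
  · exact hμ.integrableOn.const_mul _
  · filter_upwards [self_mem_ae_restrict measurableSet_Ioi] with x hx w hw
    exact hasDerivAt_Gk hx w

lemma Kh_cont (hμ : Integrable bb μ) {z : ℂ} (hz0 : z ≠ 0) :
    Tendsto (Kh μ) (nhdsWithin z {w | 0 ≤ w.re}) (nhds (Kh μ z)) := by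
  have hp : 0 < ‖z‖ := norm_pos_iff.2 hz0
  refine tendsto_integral_filter_of_dominated_convergence
    (fun x => (1 + 1 / (‖z‖ / 2)) * bb x) ?_ ?_ ?_ ?_
  · exact Eventually.of_forall fun w => (Gk_meas w).aestronglyMeasurable
  · have h1 : ∀ᶠ w in nhdsWithin z {w : ℂ | 0 ≤ w.re}, ‖z‖ / 2 < ‖w‖ :=
      nhdsWithin_le_nhds ((isOpen_lt continuous_const continuous_norm).mem_nhds
        (show ‖z‖ / 2 < ‖z‖ by linarith))
    filter_upwards [h1, self_mem_nhdsWithin] with w hw hw2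
    filter_upwards [self_mem_ae_restrict measurableSet_Ioi] with x hx
    have hw0 : w ≠ 0 := by
      rintro rfl
      simp at hw
      linarith
    refine (Gk_le_bb hx hw2 hw0).trans ?_
    have := bb_nonneg x
    gcongr
  · exact hμ.integrableOn.const_mul _
  · filter_upwards [self_mem_ae_restrict measurableSet_Ioi] with x hx
    exact ((continuous_Gk hx).tendsto z).mono_left nhdsWithin_le_nhds

lemma Kh_conj (z : ℂ) : Kh μ (starRingEnd ℂ z) = starRingEnd ℂ (Kh μ z) := by
  unfold Kh
  rw [← integral_conj]
  simp only [Gk_conj]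

lemma Kh_imag_re (hμ : Integrable bb μ) {ω : ℝ} (hω : 0 < ω) : (Kh μ (Complex.I * ω)).re =
    Real.sqrt Real.pi / 2 *
        ∫ x in Ioi (0:ℝ), (1 / Real.sqrt x) * Real.exp (-(ω ^ 2 / (4 * x))) ∂μ := by
  have hz0 : Complex.I * ω ≠ 0 := mul_ne_zero Complex.I_ne_zero (by exact_mod_cast hω.ne')
  have := integral_re (𝕜 := ℂ) (Gk_int hμ (z := Complex.I * ω) (by simp) hz0)
  simp only [RCLike.re_eq_complex_re] at this
  unfold Kh
  rw [← this, ← integral_const_mul]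
  refine setIntegral_congr_fun measurableSet_Ioi fun x hx => ?_
  rw [Gk_imag hx, Complex.sub_re, Complex.I_mul_re, Complex.ofReal_re, Complex.ofReal_im]
  simp

lemma Kh_imag_im (hμ : Integrable bb μ) {ω : ℝ} (hω : 0 < ω) : (Kh μ (Complex.I * ω)).im =
    -∫ x in Ioi (0:ℝ), (1 / Real.sqrt x) * daw (ω / (2 * Real.sqrt x)) ∂μ := by
  have hz0 : Complex.I * ω ≠ 0 := mul_ne_zero Complex.I_ne_zero (by exact_mod_cast hω.ne')
  have := integral_im (𝕜 := ℂ) (Gk_int hμ (z := Complex.I * ω) (by simp) hz0)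
  simp only [RCLike.im_eq_complex_im] at this
  unfold Kh
  rw [← this, ← integral_neg]
  refine setIntegral_congr_fun measurableSet_Ioi fun x hx => ?_
  rw [Gk_imag hx, Complex.sub_im, Complex.I_mul_im, Complex.ofReal_re, Complex.ofReal_im]
  simp

end

/-- The main computation. -/
lemma main_integral {μ : Measure ℝ} (hμ : Integrable bb μ) {m lam β : ℝ}
    (hm : 0 < m) (hlam : 0 < lam) (hβ : 0 < β) :
    ∫ ω in Ioi (0:ℝ), 2 * ((m * (Complex.I * ω) + lam + β * Kh μ (Complex.I * ω) : ℂ)⁻¹).re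
      = Real.pi / m := by
  set D : ℂ → ℂ := fun z => m * z + lam + β * Kh μ z with hD
  set F : ℂ → ℂ := fun z => (D z)⁻¹ with hF
  have hDre : ∀ z : ℂ, 0 ≤ z.re → z ≠ 0 → lam ≤ (D z).re := by
    intro z hz hz0
    have h1 := Kh_re_nonneg hμ hz hz0
    have : (D z).re = m * z.re + lam + β * (Kh μ z).re := by simp [hD]
    rw [this]
    have := mul_nonneg hm.le hz
    have := mul_nonneg hβ.le h1
    linarith
  have hD0 : ∀ z : ℂ, 0 ≤ z.re → z ≠ 0 → D z ≠ 0 := by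
    intro z hz hz0 h
    have := hDre z hz hz0
    rw [h] at this
    simp at this
    linarith
  have hFb : ∀ z : ℂ, 0 ≤ z.re → z ≠ 0 → ‖F z‖ ≤ 1 / lam := by
    intro z hz hz0
    simp only [hF]
    rw [norm_inv, ← one_div]
    gcongr
    exact (hDre z hz hz0).trans (Complex.re_le_norm _)
  have hFre : ∀ z : ℂ, 0 ≤ z.re → z ≠ 0 → 0 ≤ (F z).re := by
    intro z hz hz0
    simp only [hF]
    rw [Complex.inv_re]
    exact div_nonneg (hlam.le.trans (hDre z hz hz0)) (Complex.normSq_nonneg _)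
  have hFc : ∀ z : ℂ, 0 ≤ z.re → z ≠ 0 → Tendsto F (nhdsWithin z {w | 0 ≤ w.re}) (nhds (F z)) := by
    intro z hz hz0
    refine Tendsto.inv₀ ?_ (hD0 z hz hz0)
    have h1 : Tendsto (fun z : ℂ => (m:ℂ) * z + lam) (nhdsWithin z {w | 0 ≤ w.re})
        (nhds (m * z + lam)) :=
      (Continuous.tendsto (by fun_prop) z).mono_left nhdsWithin_le_nhds
    exact h1.add ((Kh_cont hμ hz0).const_mul (β:ℂ))
  have hFd : ∀ z : ℂ, 0 < z.re → DifferentiableAt ℂ F z := by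
    intro z hz
    have hz0 : z ≠ 0 := by rintro rfl; simp at hz
    refine DifferentiableAt.inv ?_ (hD0 z hz.le hz0)
    have := Kh_diff hμ hz
    simp only [hD]
    fun_prop
  have hFconj : ∀ z : ℂ, F (starRingEnd ℂ z) = starRingEnd ℂ (F z) := by
    intro z
    simp [hF, hD, Kh_conj]
  -- the boundary function
  set f : ℝ → ℝ := fun ω => 2 * (F (Complex.I * ω)).re with hf
  have hI0 : ∀ ω : ℝ, ω ≠ 0 → Complex.I * ω ≠ 0 := fun ω hω =>
    mul_ne_zero Complex.I_ne_zero (by exact_mod_cast hω)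
  have hf0 : ∀ ω : ℝ, ω ≠ 0 → 0 ≤ f ω := fun ω hω =>
    mul_nonneg two_pos.le (hFre _ (by simp) (hI0 ω hω))
  have hfb : ∀ ω : ℝ, ω ≠ 0 → f ω ≤ 2 * (1 / lam) := fun ω hω =>
    mul_le_mul_of_nonneg_left ((Complex.re_le_norm _).trans (hFb _ (by simp) (hI0 ω hω))) two_pos.le
  have hfc : ContinuousOn f (Ioi 0) := by
    intro ω hω
    have hω : 0 < ω := hω
    have h1 : Tendsto (fun ω : ℝ => Complex.I * (ω:ℂ)) (nhdsWithin ω (Ioi 0))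
        (nhdsWithin (Complex.I * ω) {w | 0 ≤ w.re}) := by
      refine tendsto_nhdsWithin_iff.2 ⟨(Continuous.tendsto (by fun_prop) ω).mono_left
        nhdsWithin_le_nhds, Eventually.of_forall fun t => ?_⟩
      simp
    have h2 := (hFc _ (by simp) (hI0 ω hω.ne')).comp h1
    exact ((Complex.continuous_re.tendsto _).comp h2).const_mul 2
  -- Poisson formula at the point R
  have hP : ∀ R : ℝ, 0 < R →
      ∫ ω in Ioi (0:ℝ), (R ^ 2 / (R ^ 2 + ω ^ 2)) * f ω = Real.pi * (R * (F R).re) := by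
    intro R hR
    have hp := poisson (fun z => F (R * z)) (1 / lam) ?_ ?_ ?_
    · have hint : Integrable (fun ω : ℝ => (2 / (1 + ω ^ 2)) • F (R * -(Complex.I * ω))) := by
        by_contra hcon
        rw [integral_undef hcon, mul_one] at hp
        have hRz : (R:ℂ) ≠ 0 := by exact_mod_cast hR.ne'
        have h1 : F R ≠ 0 := inv_ne_zero (hD0 R (by simpa using hR.le) hRz)
        have h2 : (Real.pi : ℂ) ≠ 0 := by exact_mod_cast Real.pi_ne_zero
        exact mul_ne_zero (mul_ne_zero two_ne_zero h2) h1 hp.symm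
      have hre := integral_re (𝕜 := ℂ) hint
      simp only [RCLike.re_eq_complex_re] at hre
      rw [hp] at hre
      have e1 : ∀ ω : ℝ, ((2 / (1 + ω ^ 2)) • F (R * -(Complex.I * ω))).re =
          (fun u : ℝ => (1 / (1 + u ^ 2)) * f (R * u)) |ω| := by
        intro ω
        have hneg : (F (R * -(Complex.I * ω))).re = (F (Complex.I * (R * ω : ℝ))).re := by
          have : (R * -(Complex.I * ω) : ℂ) = starRingEnd ℂ (Complex.I * (R * ω : ℝ)) := by
            simp; ring
          rw [this, hFconj, Complex.conj_re]
        have habs : (F (Complex.I * (R * |ω| : ℝ))).re = (F (Complex.I * (R * ω : ℝ))).re := by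
          rcases abs_choice ω with h | h
          · rw [h]
          · rw [h]
            have : (Complex.I * (R * -ω : ℝ) : ℂ) = starRingEnd ℂ (Complex.I * (R * ω : ℝ)) := by
              simp
            rw [this, hFconj, Complex.conj_re]
        simp only [hf]
        rw [Complex.smul_re, hneg, habs, sq_abs, smul_eq_mul]
        ring
      simp only [e1] at hre
      rw [integral_comp_abs (f := fun u : ℝ => (1 / (1 + u ^ 2)) * f (R * u))] at hre
      have e2 := integral_comp_mul_left_Ioi (fun ω => (R ^ 2 / (R ^ 2 + ω ^ 2)) * f ω) 0 hR
      rw [mul_zero] at e2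
      have e3 : ∀ u : ℝ, R ^ 2 / (R ^ 2 + (R * u) ^ 2) * f (R * u) = 1 / (1 + u ^ 2) * f (R * u) := by
        intro u
        congr 1
        have : 0 < 1 + u ^ 2 := by positivity
        field_simp
      simp only [e3] at e2
      rw [e2, smul_eq_mul] at hre
      have e4 : (2 * (Real.pi : ℂ) * F (R * 1)).re = 2 * Real.pi * (F R).re := by
        rw [mul_one]
        have : (2 * (Real.pi : ℂ)) = ((2 * Real.pi : ℝ) : ℂ) := by push_cast; ring
        rw [this, Complex.re_ofReal_mul]
      rw [e4] at hre
      have e5 : R * R⁻¹ = 1 := mul_inv_cancel₀ hR.ne'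
      linear_combination (R / 2) * hre - (∫ (x : ℝ) in Ioi 0, R ^ 2 / (R ^ 2 + x ^ 2) * f x) * e5
    · intro z hz
      have h1 : 0 < ((R:ℂ) * z).re := by simpa using mul_pos hR hz
      exact DifferentiableAt.comp z (g := F) (hFd _ h1) (by fun_prop)
    · intro z hz
      have h1 : 0 < ((R:ℂ) * z).re := by simpa using mul_pos hR hz
      exact hFb _ h1.le (by intro h; rw [h] at h1; simp at h1)
    · intro ω hω
      have hne : (R:ℂ) * -(Complex.I * ω) ≠ 0 :=
        mul_ne_zero (by exact_mod_cast hR.ne') (neg_ne_zero.2 (hI0 ω hω))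
      refine (hFc (R * -(Complex.I * ω)) (by simp) hne).comp ?_
      refine tendsto_nhdsWithin_iff.2 ⟨(Continuous.tendsto (by fun_prop) _).mono_left
        nhdsWithin_le_nhds, ?_⟩
      filter_upwards [self_mem_nhdsWithin] with z hz
      have : 0 < ((R:ℂ) * z).re := by simpa using mul_pos hR hz
      exact this.le
  -- asymptotics of F along the real axis
  have hlim : Tendsto (fun n : ℕ => ((n:ℝ) + 1) * (F (((n:ℝ) + 1 : ℝ) : ℂ)).re) atTop (nhds (1 / m)) := by
    have hn : Tendsto (fun n : ℕ => (n:ℝ) + 1) atTop atTop :=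
      tendsto_atTop_add_const_right _ _ tendsto_natCast_atTop_atTop
    have hinv : Tendsto (fun n : ℕ => ((n:ℝ) + 1)⁻¹) atTop (nhds 0) :=
      tendsto_inv_atTop_zero.comp hn
    have hinvc : Tendsto (fun n : ℕ => ((((n:ℝ) + 1)⁻¹ : ℝ) : ℂ)) atTop (nhds 0) := by
      exact (Complex.continuous_ofReal.tendsto' 0 0 (by simp)).comp hinv
    have hK : Tendsto (fun n : ℕ => ((((n:ℝ) + 1)⁻¹ : ℝ) : ℂ) * Kh μ (((n:ℝ) + 1 : ℝ) : ℂ))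
        atTop (nhds 0) := by
      rw [tendsto_zero_iff_norm_tendsto_zero]
      have hb : Tendsto (fun n : ℕ => ((n:ℝ) + 1)⁻¹ * (2 * ∫ x in Ioi (0:ℝ), bb x ∂μ)) atTop (nhds 0) := by
        simpa using hinv.mul_const (2 * ∫ x in Ioi (0:ℝ), bb x ∂μ)
      refine squeeze_zero (fun n => norm_nonneg _) (fun n => ?_) hb
      have hp : (0:ℝ) < (n:ℝ) + 1 := by positivity
      rw [norm_mul, Complex.norm_real, Real.norm_of_nonneg (by positivity)]
      gcongr
      have h1 := Kh_norm hμ (z := (((n:ℝ) + 1 : ℝ) : ℂ)) (by rw [Complex.ofReal_re]; exact hp.le)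
        (by exact_mod_cast hp.ne')
      refine h1.trans ?_
      have h2 : 0 ≤ ∫ x in Ioi (0:ℝ), bb x ∂μ := integral_nonneg fun x => bb_nonneg x
      gcongr
      rw [Complex.norm_real, Real.norm_of_nonneg hp.le]
      have : 1 / ((n:ℝ) + 1) ≤ 1 := by
        rw [div_le_one hp]
        have : (0:ℝ) ≤ n := n.cast_nonneg
        linarith
      linarith
    have h1 : Tendsto (fun n : ℕ => (m:ℂ) + lam * ((((n:ℝ) + 1)⁻¹ : ℝ) : ℂ) +
        β * (((((n:ℝ) + 1)⁻¹ : ℝ) : ℂ) * Kh μ (((n:ℝ) + 1 : ℝ) : ℂ))) atTop (nhds (m:ℂ)) := by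
      simpa using ((hinvc.const_mul (lam:ℂ)).const_add (m:ℂ)).add (hK.const_mul (β:ℂ))
    have h2 := (Complex.continuous_re.tendsto _).comp (h1.inv₀ (by exact_mod_cast hm.ne'))
    have h3 : ((m:ℂ)⁻¹).re = 1 / m := by
      rw [← Complex.ofReal_inv, Complex.ofReal_re, one_div]
    rw [h3] at h2
    refine h2.congr fun n => ?_
    have hp : (0:ℝ) < (n:ℝ) + 1 := by positivity
    have hpc : (((n:ℝ) + 1 : ℝ) : ℂ) ≠ 0 := by exact_mod_cast hp.ne'
    simp only [Function.comp]
    rw [← Complex.re_ofReal_mul]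
    congr 1
    simp only [hF, hD]
    set N : ℂ := (((n:ℝ) + 1 : ℝ) : ℂ)
    rw [Complex.ofReal_inv]
    have : (m:ℂ) + lam * N⁻¹ + β * (N⁻¹ * Kh μ N) = N⁻¹ * (m * N + lam + β * Kh μ N) := by
      field_simp
    rw [this, mul_inv, inv_inv]
  -- monotone convergence
  have hfm : AEStronglyMeasurable f (volume.restrict (Ioi 0)) :=
    hfc.aestronglyMeasurable measurableSet_Ioi
  have hgm : ∀ n : ℕ, AEStronglyMeasurable
      (fun ω : ℝ => (((n:ℝ) + 1) ^ 2 / (((n:ℝ) + 1) ^ 2 + ω ^ 2)) * f ω) (volume.restrict (Ioi 0)) := by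
    intro n
    refine AEStronglyMeasurable.mul (Continuous.aestronglyMeasurable ?_) hfm
    refine Continuous.div (by fun_prop) (by fun_prop) fun ω => ?_
    positivity
  have hmono := lintegral_tendsto_of_tendsto_of_monotone (μ := volume.restrict (Ioi (0:ℝ)))
    (f := fun (n : ℕ) ω => ENNReal.ofReal ((((n:ℝ) + 1) ^ 2 / (((n:ℝ) + 1) ^ 2 + ω ^ 2)) * f ω))
    (F := fun ω => ENNReal.ofReal (f ω)) (fun n => (hgm n).aemeasurable.ennreal_ofReal) ?_ ?_
  · have hval : ∀ n : ℕ, ∫⁻ ω in Ioi (0:ℝ),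
        ENNReal.ofReal ((((n:ℝ) + 1) ^ 2 / (((n:ℝ) + 1) ^ 2 + ω ^ 2)) * f ω) =
        ENNReal.ofReal (Real.pi * (((n:ℝ) + 1) * (F (((n:ℝ) + 1 : ℝ) : ℂ)).re)) := by
      intro n
      have hp : (0:ℝ) < (n:ℝ) + 1 := by positivity
      rw [← hP _ hp, ofReal_integral_eq_lintegral_ofReal]
      · by_contra hcon
        have h1 := hP _ hp
        have hpc : (((n:ℝ) + 1 : ℝ) : ℂ) ≠ 0 := by exact_mod_cast hp.ne'
        have hr : (0:ℝ) ≤ ((((n:ℝ) + 1 : ℝ) : ℂ)).re := by rw [Complex.ofReal_re]; exact hp.le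
        rw [integral_undef hcon] at h1
        have h2 : 0 < (F (((n:ℝ) + 1 : ℝ) : ℂ)).re := by
          simp only [hF]
          rw [Complex.inv_re]
          exact div_pos (hlam.trans_le (hDre _ hr hpc)) (Complex.normSq_pos.2 (hD0 _ hr hpc))
        have := mul_pos Real.pi_pos (mul_pos hp h2)
        linarith
      · filter_upwards [self_mem_ae_restrict measurableSet_Ioi] with ω hω
        have hω : 0 < ω := hω
        exact mul_nonneg (by positivity) (hf0 ω hω.ne')
    simp only [hval] at hmono
    have h2 := tendsto_nhds_unique hmono (ENNReal.tendsto_ofReal (hlim.const_mul Real.pi))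
    rw [integral_eq_lintegral_of_nonneg_ae _ hfm, h2, ENNReal.toReal_ofReal (by positivity)]
    · ring
    · filter_upwards [self_mem_ae_restrict measurableSet_Ioi] with ω hω
      have hω : 0 < ω := hω
      exact hf0 ω hω.ne'
  · filter_upwards [self_mem_ae_restrict measurableSet_Ioi] with ω hω
    have hω : 0 < ω := hω
    intro a b hab
    have hab' : (a:ℝ) ≤ b := by exact_mod_cast hab
    have := hf0 ω hω.ne'
    refine ENNReal.ofReal_le_ofReal (mul_le_mul_of_nonneg_right ?_ this)
    rw [div_le_div_iff₀ (by positivity) (by positivity)]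
    have : ((a:ℝ) + 1) ^ 2 ≤ ((b:ℝ) + 1) ^ 2 := by gcongr
    nlinarith [mul_le_mul_of_nonneg_right this (sq_nonneg ω)]
  · filter_upwards [self_mem_ae_restrict measurableSet_Ioi] with ω hω
    refine ENNReal.tendsto_ofReal ?_
    have hn : Tendsto (fun n : ℕ => (n:ℝ) + 1) atTop atTop :=
      tendsto_atTop_add_const_right _ _ tendsto_natCast_atTop_atTop
    have hinv : Tendsto (fun n : ℕ => ((n:ℝ) + 1)⁻¹) atTop (nhds 0) :=
      tendsto_inv_atTop_zero.comp hn
    have h1 : Tendsto (fun n : ℕ => (1 + (((n:ℝ) + 1)⁻¹ * ω) ^ 2)⁻¹ * f ω) atTop (nhds (f ω)) := by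
      have := (((hinv.mul_const ω).pow 2).const_add 1).inv₀ (by norm_num)
      simpa using this.mul_const (f ω)
    refine h1.congr fun n => ?_
    have hp : (0:ℝ) < (n:ℝ) + 1 := by positivity
    congr 1
    field_simp

/-- Equipartition of energy for the free-particle GLE with memory kernel
`K(t) = φ(t²) = ∫₀^∞ e^{-t²x} μ(dx)`, `φ` completely monotonic:
`∫₀^∞ r₂₂(ω) dω = π/m`. -/
theorem equipartition_free_particle_gaussian_type_kernel
    (μ : Measure ℝ) (m lam β : ℝ)
    (hm : 0 < m) (hlam : 0 < lam) (hβ : 0 < β)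
    (hμ0 : μ {0} = 0)
    (hμ01 : μ (Icc (0:ℝ) 1) < ⊤)
    (hμint : IntegrableOn (fun x : ℝ => 1 / Real.sqrt x) (Ici 1) μ)
    (Kcos Ksin : ℝ → ℝ)
    (hKcos : ∀ ω > 0, Kcos ω =
      Real.sqrt Real.pi / 2 *
        ∫ x in Ici (0:ℝ), (1 / Real.sqrt x) * Real.exp (-(ω ^ 2 / (4 * x))) ∂μ)
    (hKsin : ∀ ω > 0, Ksin ω =
      ∫ x in Ici (0:ℝ), (1 / Real.sqrt x) * daw (ω / (2 * Real.sqrt x)) ∂μ) :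
    ∫ ω in Ioi (0:ℝ),
        2 * (lam + β * Kcos ω) /
          ((m * ω - β * Ksin ω) ^ 2 + (lam + β * Kcos ω) ^ 2)
      = Real.pi / m := by
  have hμ := bb_integrable hμ01 hμint
  rw [← main_integral hμ hm hlam hβ]
  have hr : μ.restrict (Ici (0:ℝ)) = μ.restrict (Ioi (0:ℝ)) := by
    refine Measure.restrict_congr_set ?_
    rw [← Ioi_union_left]
    exact union_ae_eq_left_of_ae_eq_empty (ae_eq_empty.2 hμ0)
  refine setIntegral_congr_fun measurableSet_Ioi fun ω hω => ?_
  have hω : 0 < ω := hω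
  have h1 : Kcos ω = (Kh μ (Complex.I * ω)).re := by
    rw [hKcos ω hω, Kh_imag_re hμ hω, hr]
  have h2 : Ksin ω = -(Kh μ (Complex.I * ω)).im := by
    rw [hKsin ω hω, Kh_imag_im hμ hω, hr, neg_neg]
  rw [h1, h2, Complex.inv_re, Complex.normSq_apply, mul_div_assoc]
  have e1 : (m * (Complex.I * ω) + lam + β * Kh μ (Complex.I * ω) : ℂ).re =
      lam + β * (Kh μ (Complex.I * ω)).re := by simp
  have e2 : (m * (Complex.I * ω) + lam + β * Kh μ (Complex.I * ω) : ℂ).im =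
      m * ω + β * (Kh μ (Complex.I * ω)).im := by simp
  rw [e1, e2]
  congr 2
  ring
end

section
/- Let μ be a positive Borel measure on [0,∞) with μ({0}) = 0, μ([0,1]) < ∞ and ∫₁^∞ x⁻¹ μ(dx) < ∞, and let m, λ, β, γ > 0. For ω > 0 define 𝒦cos(ω) = ∫₀^∞ x/(x² + ω²) μ(dx), 𝒦sin(ω) = ∫₀^∞ ω/(x² + ω²) μ(dx), and r₁₁(ω) = 2(λ + β·𝒦cos(ω)) / ((γ − m·ω² + β·ω·𝒦sin(ω))² + ω²·(λ + β·𝒦cos(ω))²). Then ∫₀^∞ r₁₁(ω) dω = π/γ and ∫₀^∞ ω²·r₁₁(ω) dω = π/m. (This is the analytic content of equipartition of energy E[γ x(0)²] = E[m v(0)²] = k_B T for the generalized Langevin equation in a harmonic potential with a completely monotonic memory kernel: the position spectral density is r₁₁ and E[x(0)²] = (k_B T/π)∫₀^∞ r₁₁, E[v(0)²] = (k_B T/π)∫₀^∞ ω² r₁₁.) -/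
open MeasureTheory Filter Set

lemma exp_mem_halfplane (w : ℂ) (h1 : -(Real.pi/2) ≤ w.im) (h2 : w.im ≤ Real.pi/2) :
    Complex.exp w ∈ {s : ℂ | 0 ≤ s.re ∧ s ≠ 0} := by
  refine ⟨?_, Complex.exp_ne_zero _⟩
  rw [Complex.exp_re]
  exact mul_nonneg (Real.exp_pos _).le (Real.cos_nonneg_of_mem_Icc ⟨h1, h2⟩)

lemma integral_exp_sub (g : ℝ → ℝ) :
    ∫ x, Real.exp x * g (Real.exp x) = ∫ y in Ioi (0:ℝ), g y := by
  have h : Real.exp '' univ = Ioi 0 := by rw [image_univ, Real.range_exp]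
  symm; rw [← h]
  simpa [abs_of_pos (Real.exp_pos _)] using integral_image_eq_integral_abs_deriv_smul
      (MeasurableSet.univ) (fun x _ ↦ (Real.hasDerivAt_exp x).hasDerivWithinAt)
      (fun x _ y _ hxy ↦ Real.exp_injective hxy) g

lemma contour (G : ℂ → ℂ) (c : ℝ)
    (hc : ContinuousOn G {s : ℂ | 0 ≤ s.re ∧ s ≠ 0})
    (hd : DifferentiableOn ℂ G {s : ℂ | 0 < s.re})
    (hconj : ∀ s, G (star s) = star (G s))
    (h0 : ∀ ε > 0, ∃ r > 0, ∀ s : ℂ, 0 ≤ s.re → s ≠ 0 → ‖s‖ < r → ‖G s‖ ≤ ε)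
    (hinf : ∀ ε > 0, ∃ R > 0, ∀ s : ℂ, 0 ≤ s.re → R < ‖s‖ → ‖G s - c‖ ≤ ε)
    (hnn : ∀ ω : ℝ, 0 < ω → 0 ≤ (G (Complex.I * ω)).im) :
    ∫ ω in Ioi (0:ℝ), (G (Complex.I * ω)).im / ω = Real.pi * c / 2 := by
  have hpi := Real.pi_pos
  rw [← integral_exp_sub]
  have e1 : (fun x => Real.exp x * ((G (Complex.I * (Real.exp x : ℝ))).im / Real.exp x)) =
      fun x : ℝ => (G (Complex.I * (Real.exp x : ℝ))).im := by
    funext x; field_simp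
  rw [e1]
  set p : ℝ := Real.pi / 2 with hp
  let f : ℂ → ℂ := fun w => G (Complex.exp w)
  have hfc : ContinuousOn f {w : ℂ | -p ≤ w.im ∧ w.im ≤ p} :=
    hc.comp Complex.continuous_exp.continuousOn (fun w hw => exp_mem_halfplane w hw.1 hw.2)
  have hfd : DifferentiableOn ℂ f {w : ℂ | -p < w.im ∧ w.im < p} := by
    refine hd.comp Complex.differentiable_exp.differentiableOn (fun w hw => ?_)
    simp only [mem_ofPred_eq, Complex.exp_re]
    exact mul_pos (Real.exp_pos _) (Real.cos_pos_of_mem_Ioo hw)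
  have hpp : -p ≤ p := by linarith
  have htop : ∀ x : ℝ, f (x + (p:ℝ) * Complex.I) = G (Complex.I * (Real.exp x : ℝ)) := by
    intro x
    have : Complex.exp (x + (p:ℝ) * Complex.I) = Complex.I * (Real.exp x : ℝ) := by
      rw [Complex.exp_add, hp]; push_cast; rw [Complex.exp_pi_div_two_mul_I]; ring
    simp only [f, this]
  have hbot : ∀ x : ℝ, f (x + ((-p:ℝ):ℂ) * Complex.I) = star (G (Complex.I * (Real.exp x : ℝ))) := by
    intro x
    have : Complex.exp (x + ((-p:ℝ):ℂ) * Complex.I) = star (Complex.I * (Real.exp x : ℝ)) := by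
      rw [Complex.exp_add, hp]; push_cast
      rw [neg_mul, Complex.exp_neg, Complex.exp_pi_div_two_mul_I]
      simp [mul_comm, -Complex.ofReal_exp]
      rw [← Complex.exp_conj, Complex.conj_ofReal]
    simp only [f, this, hconj]
  have hgc : Continuous fun x : ℝ => G (Complex.I * (Real.exp x : ℝ)) := by
    have : (fun x : ℝ => G (Complex.I * (Real.exp x : ℝ))) = fun x : ℝ => f (x + (p:ℝ) * Complex.I) := by
      funext x; rw [htop]
    rw [this]
    refine hfc.comp_continuous (by fun_prop) ?_
    intro x; simp; linarith
  have key : ∀ n : ℝ, 0 ≤ n → (∫ x in (-n)..n, (G (Complex.I * (Real.exp x : ℝ))).im : ℝ) =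
      ((∫ y in (-p)..p, f (n + y * Complex.I)) - ∫ y in (-p)..p, f ((-n : ℝ) + y * Complex.I)).re / 2 := by
    intro n hn
    have H := Complex.integral_boundary_rect_eq_zero_of_continuousOn_of_differentiableOn f
      (⟨-n, -p⟩) ⟨n, p⟩ (hfc.mono ?_) (hfd.mono ?_)
    · simp only [htop, hbot] at H
      rw [← intervalIntegral.integral_sub] at H
      · have h2 : ∀ z : ℂ, star z - z = ((z.im : ℝ) : ℂ) * (-2 * Complex.I) := by
          intro z
          apply Complex.ext <;> simp
          ring
        simp only [h2] at H
        rw [intervalIntegral.integral_mul_const, intervalIntegral.integral_ofReal] at H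
        have := congrArg Complex.im H
        simp at this
        simp only [Complex.sub_re, Complex.ofReal_neg, Complex.ofReal_exp]
        linarith
      · exact (hgc.star).intervalIntegrable _ _
      · exact hgc.intervalIntegrable _ _
    · intro w hw
      have := hw.2
      simp only [mem_preimage, uIcc_of_le hpp] at this
      exact this
    · intro w hw
      have := hw.2
      simp only [mem_preimage, min_eq_left hpp, max_eq_right hpp] at this
      exact this
  have hline : ∀ (n y : ℝ), y ∈ uIoc (-p) p → 0 ≤ (Complex.exp (n + y * Complex.I)).re := by
    intro n y hy
    rw [uIoc_of_le hpp] at hy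
    exact (exp_mem_halfplane _ (by simp; linarith [hy.1]) (by simp; linarith [hy.2])).1
  have hnorm : ∀ (n y : ℝ), ‖Complex.exp (n + y * Complex.I)‖ = Real.exp n := by
    intro n y; rw [Complex.norm_exp]; simp
  have hII : ∀ n : ℝ, IntervalIntegrable (fun y : ℝ => f (n + y * Complex.I)) volume (-p) p := by
    intro n
    apply ContinuousOn.intervalIntegrable
    refine hfc.comp (by fun_prop) ?_
    intro y hy
    rw [uIcc_of_le hpp] at hy
    simpa using hy
  have hR : Tendsto (fun n : ℝ => ∫ y in (-p)..p, f (n + y * Complex.I)) atTop (nhds ((Real.pi * c : ℝ) : ℂ)) := by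
    rw [Metric.tendsto_atTop]
    intro ε hε
    obtain ⟨R, hR, h⟩ := hinf (ε / (2 * Real.pi)) (by positivity)
    refine ⟨Real.log R + 1, fun n hn => ?_⟩
    have e : ((Real.pi * c : ℝ) : ℂ) = ∫ y in (-p)..p, (c : ℂ) := by
      rw [intervalIntegral.integral_const, hp]; 
      simp
    rw [dist_eq_norm, e, ← intervalIntegral.integral_sub (hII n) (by simp)]
    refine (intervalIntegral.norm_integral_le_of_norm_le_const (C := ε / (2 * Real.pi)) ?_).trans_lt ?_
    · intro y hy
      apply h _ (hline n y hy)
      rw [hnorm, ← Real.log_lt_iff_lt_exp hR]; linarith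
    · rw [sub_neg_eq_add, hp, add_halves, abs_of_pos hpi]; field_simp; linarith
  have hL : Tendsto (fun n : ℝ => ∫ y in (-p)..p, f ((-n:ℝ) + y * Complex.I)) atTop (nhds 0) := by
    rw [Metric.tendsto_atTop]
    intro ε hε
    obtain ⟨R, hR, h⟩ := h0 (ε / (2 * Real.pi)) (by positivity)
    refine ⟨-Real.log R + 1, fun n hn => ?_⟩
    rw [dist_eq_norm, sub_zero]
    refine (intervalIntegral.norm_integral_le_of_norm_le_const (C := ε / (2 * Real.pi)) ?_).trans_lt ?_
    · intro y hy
      apply h _ (hline (-n) y hy) (Complex.exp_ne_zero _)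
      rw [hnorm, ← Real.lt_log_iff_exp_lt hR]; linarith
    · rw [sub_neg_eq_add, hp, add_halves, abs_of_pos hpi]; field_simp; linarith
  have hT : Tendsto (fun n : ℝ => ∫ x in (-n)..n, (G (Complex.I * (Real.exp x : ℝ))).im) atTop
      (nhds (Real.pi * c / 2)) := by
    have := ((Complex.continuous_re.tendsto _).comp (hR.sub hL)).div_const 2
    simp only [sub_zero, Complex.ofReal_re] at this
    refine this.congr' ?_
    filter_upwards [eventually_ge_atTop 0] with n hn
    rw [key n hn]; rfl
  refine (aecover_Ioc (μ := volume) (l := (atTop : Filter ℝ)) (a := fun n : ℝ => -n) (b := fun n => n)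
    tendsto_neg_atTop_atBot tendsto_id).integral_eq_of_tendsto_of_nonneg_ae _
    (ae_of_all _ fun x => hnn _ (Real.exp_pos x)) ?_ ?_
  · intro n
    exact ((Complex.continuous_im.comp hgc).continuousOn.integrableOn_Icc).mono_set Ioc_subset_Icc_self
  · refine hT.congr' ?_
    filter_upwards [eventually_ge_atTop 0] with n hn
    rw [intervalIntegral.integral_of_le (by linarith)]

/-- The dominating function. -/
noncomputable def domF (x : ℝ) : ℝ := (max 1 x)⁻¹

/-- Laplace transform of the kernel. -/
noncomputable def Khat (ν : Measure ℝ) (s : ℂ) : ℂ := ∫ x : ℝ, ((x:ℂ) + s)⁻¹ ∂ν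

lemma domF_pos (x : ℝ) : 0 < domF x := by
  unfold domF; have : (1:ℝ) ≤ max 1 x := le_max_left _ _
  positivity

lemma domF_le_one (x : ℝ) : domF x ≤ 1 := by
  unfold domF; exact inv_le_one_of_one_le₀ (le_max_left _ _)

lemma norm_ge_x (x : ℝ) (s : ℂ) (hs : 0 ≤ s.re) : x ≤ ‖(x:ℂ) + s‖ := by
  have := Complex.re_le_norm ((x:ℂ) + s)
  simp at this; linarith

lemma norm_ge_s (x : ℝ) (hx : 0 < x) (s : ℂ) (hs : 0 ≤ s.re) : ‖s‖ ≤ ‖(x:ℂ) + s‖ := by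
  rw [Complex.norm_def, Complex.norm_def]
  apply Real.sqrt_le_sqrt
  simp [Complex.normSq_apply]
  nlinarith

lemma add_ne (x : ℝ) (hx : 0 < x) (s : ℂ) (hs : 0 ≤ s.re) : (x:ℂ) + s ≠ 0 := by
  have := norm_ge_x x s hs
  intro h; rw [h, norm_zero] at this; linarith

lemma inv_bound (δ : ℝ) (hδ : 0 < δ) (hδ1 : δ ≤ 1) (x : ℝ) (hx : 0 < x) (s : ℂ) (hs : 0 ≤ s.re)
    (hsδ : δ ≤ ‖s‖) : ‖((x:ℂ) + s)⁻¹‖ ≤ δ⁻¹ * domF x := by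
  unfold domF
  rw [norm_inv, ← mul_inv]
  have h1 := norm_ge_x x s hs
  have h2 := norm_ge_s x hx s hs
  have h3 : (1:ℝ) ≤ max 1 x := le_max_left _ _
  apply inv_anti₀ (by positivity)
  rcases max_cases 1 x with ⟨h, _⟩ | ⟨h, _⟩ <;> rw [h] <;> nlinarith

lemma inv_meas (ν : Measure ℝ) (s : ℂ) : AEStronglyMeasurable (fun x : ℝ => ((x:ℂ) + s)⁻¹) ν := by
  apply Measurable.aestronglyMeasurable; fun_prop

lemma Khat_integrable {ν : Measure ℝ} (hν : ∀ᵐ x ∂ν, 0 < x) (hD : Integrable domF ν) 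
     (s : ℂ) (hs : 0 ≤ s.re) (h0 : s ≠ 0) :
    Integrable (fun x : ℝ => ((x:ℂ) + s)⁻¹) ν := by
  have hn : 0 < ‖s‖ := norm_pos_iff.2 h0
  refine (hD.const_mul (min 1 ‖s‖)⁻¹).mono' (inv_meas ν s) ?_
  filter_upwards [hν] with x hx
  exact inv_bound _ (by positivity) (min_le_left _ _) x hx s hs (min_le_right _ _)

lemma Khat_cont {ν : Measure ℝ} (hν : ∀ᵐ x ∂ν, 0 < x) (hD : Integrable domF ν) 
     : ContinuousOn (Khat ν) {s : ℂ | 0 ≤ s.re ∧ s ≠ 0} := by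
  intro s hs
  have hn : 0 < ‖s‖ := norm_pos_iff.2 hs.2
  set δ := min 1 (‖s‖/2)
  have hδ : 0 < δ := by positivity
  refine continuousWithinAt_of_dominated (bound := fun x => δ⁻¹ * domF x)
    (Eventually.of_forall fun z => inv_meas ν z) ?_ (hD.const_mul _) ?_
  · have : ∀ᶠ z : ℂ in nhds s, ‖s‖/2 < ‖z‖ :=
      continuous_norm.continuousAt.eventually (lt_mem_nhds (by linarith))
    filter_upwards [self_mem_nhdsWithin, mem_nhdsWithin_of_mem_nhds this] with z hz hz2
    filter_upwards [hν] with x hx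
    exact inv_bound δ hδ (min_le_left _ _) x hx z hz.1 ((min_le_right _ _).trans hz2.le)
  · filter_upwards [hν] with x hx
    apply ContinuousAt.continuousWithinAt
    exact (continuousAt_const.add continuousAt_id).inv₀ (add_ne x hx s hs.1)

lemma Khat_diff {ν : Measure ℝ} (hν : ∀ᵐ x ∂ν, 0 < x) (hD : Integrable domF ν) 
     : DifferentiableOn ℂ (Khat ν) {s : ℂ | 0 < s.re} := by
  intro s hs
  simp only [mem_ofPred_eq] at hs
  apply DifferentiableAt.differentiableWithinAt
  set δ := min 1 (s.re/2)
  have hδ : 0 < δ := by positivity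
  have hU : {z : ℂ | s.re/2 < z.re} ∈ nhds s :=
    (isOpen_lt continuous_const Complex.continuous_re).mem_nhds (by simp only [mem_ofPred_eq]; linarith)
  refine (hasDerivAt_integral_of_dominated_loc_of_deriv_le (F := fun (z : ℂ) (x : ℝ) => ((x:ℂ) + z)⁻¹)
    (F' := fun (z : ℂ) (x : ℝ) => -1 / ((x:ℂ) + z)^2)
    (bound := fun x => δ⁻¹ * δ⁻¹ * domF x) hU
    (Eventually.of_forall fun z => inv_meas ν z) (Khat_integrable hν hD s hs.le ?_) ?_ ?_
    (hD.const_mul _) ?_).2.differentiableAt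
  · rintro rfl; simp at hs
  · apply Measurable.aestronglyMeasurable; fun_prop
  · filter_upwards [hν] with x hx z hz
    have hz : s.re/2 < z.re := hz
    have hz0 : 0 ≤ z.re := by linarith
    have h := inv_bound δ hδ (min_le_left _ _) x hx z hz0
      ((min_le_right _ _).trans (hz.le.trans (Complex.re_le_norm z)))
    have h1 := domF_pos x
    have h2 := domF_le_one x
    have : -1 / ((x:ℂ) + z)^2 = -(((x:ℂ) + z)⁻¹ * ((x:ℂ) + z)⁻¹) := by
      rw [neg_div, one_div, sq, mul_inv]
    rw [this, norm_neg, norm_mul]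
    calc _ ≤ (δ⁻¹ * domF x) * (δ⁻¹ * domF x) := by gcongr
      _ = δ⁻¹ * δ⁻¹ * domF x * domF x := by ring
      _ ≤ δ⁻¹ * δ⁻¹ * domF x * 1 := by gcongr
      _ = _ := by ring
  · filter_upwards [hν] with x hx z hz
    have hz : s.re/2 < z.re := hz
    have hne := add_ne x hx z (by linarith)
    exact ((hasDerivAt_id z).const_add (x:ℂ)).inv hne

lemma Khat_conj {ν : Measure ℝ} (s : ℂ) : Khat ν (star s) = star (Khat ν s) := by
  unfold Khat
  have := integral_conj (μ := ν) (f := fun x : ℝ => ((x:ℂ) + s)⁻¹)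
  simp only [map_inv₀, map_add, Complex.conj_ofReal] at this
  exact this

lemma Khat_re {ν : Measure ℝ} (hν : ∀ᵐ x ∂ν, 0 < x) (hD : Integrable domF ν) 
     (s : ℂ) (hs : 0 ≤ s.re) (h0 : s ≠ 0) : 0 ≤ (Khat ν s).re := by
  unfold Khat
  have := integral_re (𝕜 := ℂ) (Khat_integrable hν hD s hs h0)
  simp only [RCLike.re_eq_complex_re] at this
  rw [← this]
  apply integral_nonneg_of_ae
  filter_upwards [hν] with x hx
  simp only [Pi.zero_apply, Complex.inv_re]
  apply div_nonneg _ (Complex.normSq_nonneg _)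
  simp; linarith

lemma Khat_bdd {ν : Measure ℝ} (hν : ∀ᵐ x ∂ν, 0 < x) (hD : Integrable domF ν) 
     : ∃ C : ℝ, 0 ≤ C ∧ ∀ s : ℂ, 0 ≤ s.re → 1 ≤ ‖s‖ → ‖Khat ν s‖ ≤ C := by
  refine ⟨∫ x, domF x ∂ν, integral_nonneg fun x => (domF_pos x).le, fun s hs h1 => ?_⟩
  refine norm_integral_le_of_norm_le hD ?_
  filter_upwards [hν] with x hx
  simpa using inv_bound 1 one_pos le_rfl x hx s hs h1

lemma Khat_zero {ν : Measure ℝ} (hν : ∀ᵐ x ∂ν, 0 < x) (hD : Integrable domF ν) 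
     : Tendsto (fun s => s * Khat ν s) (nhdsWithin 0 {s : ℂ | 0 ≤ s.re ∧ s ≠ 0}) (nhds 0) := by
  unfold Khat
  simp only [← integral_const_mul]
  have := tendsto_integral_filter_of_dominated_convergence (μ := ν)
    (l := nhdsWithin 0 {s : ℂ | 0 ≤ s.re ∧ s ≠ 0})
    (F := fun (s : ℂ) (x : ℝ) => s * ((x:ℂ) + s)⁻¹) (f := fun _ => 0) domF
    (Eventually.of_forall fun z => (inv_meas ν z).const_mul z) ?_ hD ?_
  · simpa using this
  · have hb : ∀ᶠ z : ℂ in nhds 0, ‖z‖ < 1 :=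
      continuous_norm.continuousAt.eventually (gt_mem_nhds (by simp))
    filter_upwards [self_mem_nhdsWithin, mem_nhdsWithin_of_mem_nhds hb] with s hs hs1
    filter_upwards [hν] with x hx
    have hn : 0 < ‖s‖ := norm_pos_iff.2 hs.2
    have := inv_bound ‖s‖ hn hs1.le x hx s hs.1 le_rfl
    rw [norm_mul]
    calc _ ≤ ‖s‖ * (‖s‖⁻¹ * domF x) := by gcongr
      _ = domF x := by field_simp
  · filter_upwards [hν] with x hx
    apply Tendsto.mono_left _ nhdsWithin_le_nhds
    have : ContinuousAt (fun s : ℂ => s * ((x:ℂ) + s)⁻¹) 0 :=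
      continuousAt_id.mul ((continuousAt_const.add continuousAt_id).inv₀ (add_ne x hx 0 (by simp)))
    simpa [ContinuousAt] using this


/-- The characteristic function `γ + m s² + s (lam + β K̂(s))`. -/
noncomputable def Hf (ν : Measure ℝ) (m lam β γ : ℝ) (s : ℂ) : ℂ :=
  γ + m * s ^ 2 + lam * s + β * (s * Khat ν s)

lemma Hf_ne {ν : Measure ℝ} (hν : ∀ᵐ x ∂ν, 0 < x) (hD : Integrable domF ν) {m lam β γ : ℝ}
    (hm : 0 < m) (hlam : 0 < lam) (hβ : 0 < β) (hγ : 0 < γ) (s : ℂ) (hs : 0 ≤ s.re) (h0 : s ≠ 0) : Hf ν m lam β γ s ≠ 0 := by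
  intro h
  have hK := Khat_re hν hD s hs h0
  have e : Hf ν m lam β γ s = s * (γ * s⁻¹ + m * s + lam + β * Khat ν s) := by
    unfold Hf; field_simp
  rw [e] at h
  have h2 := (mul_eq_zero.1 h).resolve_left h0
  have h3 := congrArg Complex.re h2
  simp [-mul_eq_zero] at h3
  have h4 : 0 ≤ s.re / Complex.normSq s := div_nonneg hs (Complex.normSq_nonneg _)
  have h5 := mul_nonneg hγ.le h4
  have h6 := mul_nonneg hm.le hs
  have h7 := mul_nonneg hβ.le hK
  linarith

lemma Hf_cont {ν : Measure ℝ} (hν : ∀ᵐ x ∂ν, 0 < x) (hD : Integrable domF ν) {m lam β γ : ℝ}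
     : ContinuousOn (Hf ν m lam β γ) {s : ℂ | 0 ≤ s.re ∧ s ≠ 0} := by
  have := Khat_cont hν hD
  unfold Hf; fun_prop

lemma Hf_diff {ν : Measure ℝ} (hν : ∀ᵐ x ∂ν, 0 < x) (hD : Integrable domF ν) {m lam β γ : ℝ}
     : DifferentiableOn ℂ (Hf ν m lam β γ) {s : ℂ | 0 < s.re} := by
  have := Khat_diff hν hD
  unfold Hf; fun_prop

lemma Hf_conj {ν : Measure ℝ} {m lam β γ : ℝ} (s : ℂ) : Hf ν m lam β γ (star s) = star (Hf ν m lam β γ s) := by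
  unfold Hf
  rw [Khat_conj]
  simp

lemma Hf_zero {ν : Measure ℝ} (hν : ∀ᵐ x ∂ν, 0 < x) (hD : Integrable domF ν) {m lam β γ : ℝ}
     : Tendsto (Hf ν m lam β γ) (nhdsWithin 0 {s : ℂ | 0 ≤ s.re ∧ s ≠ 0}) (nhds γ) := by
  have h1 := (Khat_zero hν hD).const_mul (β : ℂ)
  have h2 : Tendsto (fun s : ℂ => (γ:ℂ) + m * s ^ 2 + lam * s)
      (nhdsWithin 0 {s : ℂ | 0 ≤ s.re ∧ s ≠ 0}) (nhds γ) := by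
    apply Tendsto.mono_left _ nhdsWithin_le_nhds
    have : ContinuousAt (fun s : ℂ => (γ:ℂ) + m * s ^ 2 + lam * s) 0 := by fun_prop
    simpa [ContinuousAt] using this
  have h3 := h2.add h1
  rw [mul_zero, add_zero] at h3
  exact h3

lemma Hf_inf {ν : Measure ℝ} (hν : ∀ᵐ x ∂ν, 0 < x) (hD : Integrable domF ν) {m lam β γ : ℝ}
    (hlam : 0 < lam) (hβ : 0 < β) (hγ : 0 < γ) : ∃ C : ℝ, 0 ≤ C ∧ ∀ s : ℂ, 0 ≤ s.re → 1 ≤ ‖s‖ →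
    ‖Hf ν m lam β γ s - m * s ^ 2‖ ≤ C * ‖s‖ := by
  obtain ⟨C, hC, h⟩ := Khat_bdd hν hD
  refine ⟨γ + lam + β * C, by positivity, fun s hs h1 => ?_⟩
  have e : Hf ν m lam β γ s - m * s ^ 2 = γ + lam * s + β * (s * Khat ν s) := by unfold Hf; ring
  rw [e]
  have hK := h s hs h1
  calc _ ≤ ‖(γ:ℂ)‖ + ‖(lam:ℂ) * s‖ + ‖(β:ℂ) * (s * Khat ν s)‖ := norm_add₃_le
    _ = γ + lam * ‖s‖ + β * (‖s‖ * ‖Khat ν s‖) := by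
      simp [abs_of_pos, hγ, hlam, hβ]
    _ ≤ γ * ‖s‖ + lam * ‖s‖ + β * (‖s‖ * C) := by
      gcongr; nlinarith
    _ = _ := by ring

lemma Hf_inf2 {ν : Measure ℝ} (hν : ∀ᵐ x ∂ν, 0 < x) (hD : Integrable domF ν) {m lam β γ : ℝ}
    (hm : 0 < m) (hlam : 0 < lam) (hβ : 0 < β) (hγ : 0 < γ) : ∃ C : ℝ, 0 ≤ C ∧ ∀ M > 0, ∃ R > 0, ∀ s : ℂ, 0 ≤ s.re → R < ‖s‖ → 1 ≤ ‖s‖ ∧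
    ‖Hf ν m lam β γ s - m * s ^ 2‖ ≤ C * ‖s‖ ∧ M * ‖s‖ ≤ ‖Hf ν m lam β γ s‖ := by
  obtain ⟨C, hC, h⟩ := Hf_inf hν hD hlam hβ hγ (m := m)
  refine ⟨C, hC, fun M hM => ⟨1 + (C + M) / m, by positivity, fun s hs hR => ?_⟩⟩
  have hq : 0 ≤ (C + M) / m := by positivity
  have h1 : 1 ≤ ‖s‖ := by linarith
  have h2 := h s hs h1
  refine ⟨h1, h2, ?_⟩
  have h3 : ‖(m:ℂ) * s ^ 2‖ ≤ ‖Hf ν m lam β γ s‖ + ‖Hf ν m lam β γ s - m * s ^ 2‖ := by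
    rw [norm_sub_rev]
    calc _ = ‖Hf ν m lam β γ s + (m * s ^ 2 - Hf ν m lam β γ s)‖ := by congr 1; ring
      _ ≤ _ := norm_add_le _ _
  have h4 : ‖(m:ℂ) * s ^ 2‖ = m * ‖s‖ ^ 2 := by simp [abs_of_pos hm]
  have h5 : C + M ≤ m * ‖s‖ := by
    have : (C + M) / m ≤ ‖s‖ := by linarith
    rw [div_le_iff₀ hm] at this; linarith
  have h6 : (C + M) * ‖s‖ ≤ m * ‖s‖ * ‖s‖ := by gcongr
  nlinarith

lemma final1 {ν : Measure ℝ} (hν : ∀ᵐ x ∂ν, 0 < x) (hD : Integrable domF ν) {m lam β γ : ℝ}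
    (hm : 0 < m) (hlam : 0 < lam) (hβ : 0 < β) (hγ : 0 < γ) (hnn : ∀ ω : ℝ, 0 < ω → 0 ≤ (1 - γ / Hf ν m lam β γ (Complex.I * ω)).im) :
    ∫ ω in Ioi (0:ℝ), (1 - γ / Hf ν m lam β γ (Complex.I * ω)).im / ω = Real.pi / 2 := by
  have hc := Hf_cont hν hD (m := m) (lam := lam) (β := β) (γ := γ)
  have hd := Hf_diff hν hD (m := m) (lam := lam) (β := β) (γ := γ)
  have hne := Hf_ne hν hD hm hlam hβ hγ
  have hγ0 : (γ:ℂ) ≠ 0 := by exact_mod_cast hγ.ne'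
  have := contour (fun s => 1 - γ / Hf ν m lam β γ s) 1 ?_ ?_ ?_ ?_ ?_ hnn
  · simpa using this
  · exact continuousOn_const.sub (continuousOn_const.div hc fun s hs => hne s hs.1 hs.2)
  · refine (differentiableOn_const _).sub ((differentiableOn_const _).div hd fun s hs => hne s (le_of_lt hs) ?_)
    rintro rfl; simp at hs
  · intro s; simp only [Hf_conj]; simp
  · intro ε hε
    have h := ((tendsto_const_nhds (x := (γ:ℂ))).div (Hf_zero hν hD (m := m) (lam := lam) (β := β) (γ := γ)) hγ0).const_sub 1
    rw [div_self hγ0, sub_self, Metric.tendsto_nhdsWithin_nhds] at h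
    obtain ⟨r, hr, h⟩ := h ε hε
    refine ⟨r, hr, fun s hs h0 hsr => ?_⟩
    have := h (x := s) ⟨hs, h0⟩ (by simpa using hsr)
    simpa using this.le
  · intro ε hε
    obtain ⟨C, hC, h⟩ := Hf_inf2 hν hD hm hlam hβ hγ
    obtain ⟨R, hR, h⟩ := h (γ / ε) (by positivity)
    refine ⟨R, hR, fun s hs hsR => ?_⟩
    obtain ⟨h1, h2, h3⟩ := h s hs hsR
    have h4 : γ / ε ≤ ‖Hf ν m lam β γ s‖ := by
      have : 0 < γ / ε := by positivity
      nlinarith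
    have h5 : 0 < ‖Hf ν m lam β γ s‖ := lt_of_lt_of_le (by positivity) h4
    have e : (1 - γ / Hf ν m lam β γ s) - ((1:ℝ):ℂ) = -(γ / Hf ν m lam β γ s) := by push_cast; ring
    rw [e, norm_neg, norm_div, div_le_iff₀ h5]
    rw [div_le_iff₀ hε] at h4
    simp [abs_of_pos hγ]; linarith

lemma final2 {ν : Measure ℝ} (hν : ∀ᵐ x ∂ν, 0 < x) (hD : Integrable domF ν) {m lam β γ : ℝ}
    (hm : 0 < m) (hlam : 0 < lam) (hβ : 0 < β) (hγ : 0 < γ) (hnn : ∀ ω : ℝ, 0 < ω → 0 ≤ ((Complex.I * ω) ^ 2 / Hf ν m lam β γ (Complex.I * ω)).im) :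
    ∫ ω in Ioi (0:ℝ), ((Complex.I * ω) ^ 2 / Hf ν m lam β γ (Complex.I * ω)).im / ω
      = Real.pi * m⁻¹ / 2 := by
  have hc := Hf_cont hν hD (m := m) (lam := lam) (β := β) (γ := γ)
  have hd := Hf_diff hν hD (m := m) (lam := lam) (β := β) (γ := γ)
  have hne := Hf_ne hν hD hm hlam hβ hγ
  have hγ0 : (γ:ℂ) ≠ 0 := by exact_mod_cast hγ.ne'
  have hm0 : (m:ℂ) ≠ 0 := by exact_mod_cast hm.ne'
  refine contour (fun s => s ^ 2 / Hf ν m lam β γ s) m⁻¹ ?_ ?_ ?_ ?_ ?_ hnn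
  · exact (by fun_prop : ContinuousOn (fun s : ℂ => s ^ 2) _).div hc fun s hs => hne s hs.1 hs.2
  · refine (by fun_prop : DifferentiableOn ℂ (fun s : ℂ => s ^ 2) _).div hd fun s hs => hne s (le_of_lt hs) ?_
    rintro rfl; simp at hs
  · intro s; simp only [Hf_conj]; simp
  · intro ε hε
    have hsq : Tendsto (fun s : ℂ => s ^ 2) (nhdsWithin 0 {s : ℂ | 0 ≤ s.re ∧ s ≠ 0}) (nhds 0) := by
      apply Tendsto.mono_left _ nhdsWithin_le_nhds
      have : ContinuousAt (fun s : ℂ => s ^ 2) 0 := by fun_prop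
      simpa [ContinuousAt] using this
    have h := hsq.div (Hf_zero hν hD (m := m) (lam := lam) (β := β) (γ := γ)) hγ0
    rw [zero_div, Metric.tendsto_nhdsWithin_nhds] at h
    obtain ⟨r, hr, h⟩ := h ε hε
    refine ⟨r, hr, fun s hs h0 hsr => ?_⟩
    have := h (x := s) ⟨hs, h0⟩ (by simpa using hsr)
    simpa using this.le
  · intro ε hε
    obtain ⟨C, hC, h⟩ := Hf_inf2 hν hD hm hlam hβ hγ
    obtain ⟨R, hR, h⟩ := h ((C + 1) / (m * ε)) (by positivity)
    refine ⟨R, hR, fun s hs hsR => ?_⟩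
    obtain ⟨h1, h2, h3⟩ := h s hs hsR
    have h5 : 0 < ‖Hf ν m lam β γ s‖ := lt_of_lt_of_le (by positivity) h3
    have hH : Hf ν m lam β γ s ≠ 0 := norm_pos_iff.1 h5
    have e : s ^ 2 / Hf ν m lam β γ s - ((m⁻¹:ℝ):ℂ) =
        -((Hf ν m lam β γ s - m * s ^ 2) / (m * Hf ν m lam β γ s)) := by
      push_cast; field_simp; ring
    have hmn : ‖(m:ℂ)‖ = m := by simp [abs_of_pos hm]
    rw [e, norm_neg, norm_div, norm_mul, hmn, div_le_iff₀ (by positivity)]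
    rw [div_mul_eq_mul_div, div_le_iff₀ (by positivity)] at h3
    nlinarith

lemma Khat_I {ν : Measure ℝ} (hν : ∀ᵐ x ∂ν, 0 < x) (hD : Integrable domF ν) 
     (ω : ℝ) (hω : 0 < ω) :
    (Khat ν (Complex.I * ω)).re = ∫ x, x / (x ^ 2 + ω ^ 2) ∂ν ∧
    (Khat ν (Complex.I * ω)).im = -∫ x, ω / (x ^ 2 + ω ^ 2) ∂ν := by
  have hi := Khat_integrable hν hD (Complex.I * ω) (by simp) (by simp [hω.ne'])
  have h1 := integral_re (𝕜 := ℂ) hi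
  have h2 := integral_im (𝕜 := ℂ) hi
  simp only [RCLike.re_eq_complex_re, RCLike.im_eq_complex_im] at h1 h2
  unfold Khat
  rw [← h1, ← h2, ← integral_neg]
  constructor <;> congr 1 <;> funext x <;>
    simp [Complex.inv_re, Complex.inv_im, Complex.normSq_apply, sq, neg_div]


/-- Equipartition of energy for the harmonically bounded GLE with a completely
monotonic memory kernel: `∫₀^∞ r₁₁(ω) dω = π/γ` and `∫₀^∞ ω² r₁₁(ω) dω = π/m`. -/
theorem equipartition_harmonic_completely_monotonic
    (μ : Measure ℝ) (m lam β γ : ℝ)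
    (hm : 0 < m) (hlam : 0 < lam) (hβ : 0 < β) (hγ : 0 < γ)
    (hμ0 : μ {0} = 0)
    (hμ01 : μ (Icc (0:ℝ) 1) < ⊤)
    (hμint : IntegrableOn (fun x : ℝ => x⁻¹) (Ici 1) μ)
    (Kcos Ksin : ℝ → ℝ)
    (hKcos : ∀ ω > 0, Kcos ω = ∫ x in Ici (0:ℝ), x / (x ^ 2 + ω ^ 2) ∂μ)
    (hKsin : ∀ ω > 0, Ksin ω = ∫ x in Ici (0:ℝ), ω / (x ^ 2 + ω ^ 2) ∂μ)
    (r11 : ℝ → ℝ)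
    (hr11 : ∀ ω > 0, r11 ω =
      2 * (lam + β * Kcos ω) /
        ((γ - m * ω ^ 2 + β * ω * Ksin ω) ^ 2 + ω ^ 2 * (lam + β * Kcos ω) ^ 2)) :
    (∫ ω in Ioi (0:ℝ), r11 ω = Real.pi / γ) ∧
    (∫ ω in Ioi (0:ℝ), ω ^ 2 * r11 ω = Real.pi / m) := by
  set ν := μ.restrict (Ici (0:ℝ)) with hνdef
  have hν : ∀ᵐ x ∂ν, 0 < x := by
    have h1 : ∀ᵐ x ∂ν, x ∈ Ici (0:ℝ) := ae_restrict_mem measurableSet_Ici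
    have h2 : ∀ᵐ x ∂ν, x ≠ 0 := by
      apply ae_restrict_of_ae
      rw [ae_iff]; simpa using hμ0
    filter_upwards [h1, h2] with x hx hx0
    exact lt_of_le_of_ne hx (Ne.symm hx0)
  have hD : Integrable domF ν := by
    have hu : Ici (0:ℝ) = Icc 0 1 ∪ Ici 1 := (Icc_union_Ici_eq_Ici zero_le_one).symm
    rw [hνdef, ← IntegrableOn, hu]
    apply IntegrableOn.union
    · have : IntegrableOn (fun _ : ℝ => (1:ℝ)) (Icc 0 1) μ := by
        rw [integrableOn_const_iff]; right; exact hμ01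
      refine this.congr_fun (fun x hx => ?_) measurableSet_Icc
      simp [domF, max_eq_left hx.2]
    · refine hμint.congr_fun (fun x hx => ?_) measurableSet_Ici
      have hx : 1 ≤ x := hx
      simp [domF, max_eq_right hx]
  have hH : ∀ ω : ℝ, 0 < ω → (Hf ν m lam β γ (Complex.I * ω)).re = γ - m * ω ^ 2 + β * ω * Ksin ω ∧
      (Hf ν m lam β γ (Complex.I * ω)).im = ω * (lam + β * Kcos ω) := by
    intro ω hω
    obtain ⟨h1, h2⟩ := Khat_I hν hD ω hω
    rw [← hKcos ω hω] at h1
    rw [← hKsin ω hω] at h2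
    unfold Hf
    constructor
    · simp [h1, h2, sq]; ring
    · simp [h1, h2, sq]; ring
  have hK : ∀ ω : ℝ, 0 < ω → 0 ≤ Kcos ω := by
    intro ω hω
    rw [hKcos ω hω, ← (Khat_I hν hD ω hω).1]
    exact Khat_re hν hD _ (by simp) (by simp [hω.ne'])
  have hr : ∀ ω : ℝ, 0 < ω → r11 ω = 2 * (lam + β * Kcos ω) / Complex.normSq (Hf ν m lam β γ (Complex.I * ω)) := by
    intro ω hω
    rw [hr11 ω hω, Complex.normSq_apply, (hH ω hω).1, (hH ω hω).2]
    congr 1; ring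
  have hrnn : ∀ ω : ℝ, 0 < ω → 0 ≤ r11 ω := by
    intro ω hω
    rw [hr ω hω]
    have := hK ω hω
    exact div_nonneg (by positivity) (Complex.normSq_nonneg _)
  have e1 : ∀ ω : ℝ, 0 < ω → (1 - γ / Hf ν m lam β γ (Complex.I * ω)).im = γ / 2 * (ω * r11 ω) := by
    intro ω hω
    rw [hr ω hω, div_eq_mul_inv (γ:ℂ), Complex.sub_im, Complex.im_ofReal_mul, Complex.inv_im, (hH ω hω).2]
    simp; ring
  have e2 : ∀ ω : ℝ, 0 < ω → ((Complex.I * ω) ^ 2 / Hf ν m lam β γ (Complex.I * ω)).im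
      = ω ^ 3 / 2 * r11 ω := by
    intro ω hω
    have : (Complex.I * ω) ^ 2 = ((-ω^2 : ℝ) : ℂ) := by push_cast; rw [mul_pow, Complex.I_sq]; ring
    rw [hr ω hω, this, div_eq_mul_inv, Complex.im_ofReal_mul, Complex.inv_im, (hH ω hω).2]
    ring
  constructor
  · have h := final1 hν hD hm hlam hβ hγ (fun ω hω => by
      rw [e1 ω hω]; have := hrnn ω hω; positivity)
    have h2 : ∫ ω in Ioi (0:ℝ), (1 - γ / Hf ν m lam β γ (Complex.I * ω)).im / ω
        = ∫ ω in Ioi (0:ℝ), γ / 2 * r11 ω := by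
      refine setIntegral_congr_fun measurableSet_Ioi fun ω hω => ?_
      have hω : 0 < ω := hω
      simp only [e1 ω hω]; field_simp
    rw [h2, integral_const_mul] at h
    field_simp at h ⊢
    linarith
  · have h := final2 hν hD hm hlam hβ hγ (fun ω hω => by
      rw [e2 ω hω]; have := hrnn ω hω; positivity)
    have h2 : ∫ ω in Ioi (0:ℝ), ((Complex.I * ω) ^ 2 / Hf ν m lam β γ (Complex.I * ω)).im / ω
        = ∫ ω in Ioi (0:ℝ), 1 / 2 * (ω ^ 2 * r11 ω) := by
      refine setIntegral_congr_fun measurableSet_Ioi fun ω hω => ?_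
      have hω : 0 < ω := hω
      simp only [e2 ω hω]; field_simp
    rw [h2, integral_const_mul] at h
    field_simp at h ⊢
    linarith
end

section
/- Let μ be a positive Borel measure on [0,∞) with μ({0}) = 0, μ([0,1]) < ∞ and ∫₁^∞ x^{−1/2} μ(dx) < ∞, and let m, λ, β, γ > 0. For ω > 0 define 𝒦cos(ω) = (√π/2) ∫₀^∞ x^{−1/2} e^{−ω²/(4x)} μ(dx), 𝒦sin(ω) = ∫₀^∞ x^{−1/2} daw(ω/(2√x)) μ(dx) with daw(y) = e^{−y²}∫₀^y e^{s²}ds, and r₁₁(ω) = 2(λ + β·𝒦cos(ω)) / ((γ − m·ω² + β·ω·𝒦sin(ω))² + ω²·(λ + β·𝒦cos(ω))²). Then ∫₀^∞ r₁₁(ω) dω = π/γ and ∫₀^∞ ω²·r₁₁(ω) dω = π/m. (This is the analytic content of equipartition of energy E[γ x(0)²] = E[m v(0)²] = k_B T for the generalized Langevin equation in a harmonic potential with memory kernel K(t) = φ(t²), φ completely monotonic.) -/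
open MeasureTheory Filter Set

lemma aux_integrable_s3 (z : ℂ) : Integrable (fun t : ℝ => Complex.exp (-z * t - t ^ 2)) := by
  have h := integrable_cexp_quadratic (b := 1) (by simp) (-z) 0
  refine h.congr (Eventually.of_forall fun t => ?_)
  simp only
  congr 1
  ring

lemma aux_norm (z : ℂ) (t : ℝ) :
    ‖Complex.exp (-z * t - t ^ 2)‖ = Real.exp (-z.re * t - t ^ 2) := by
  rw [Complex.norm_exp]
  congr 1
  have : ((t:ℂ) ^ 2) = ((t ^ 2 : ℝ) : ℂ) := by push_cast; rfl
  rw [this, Complex.sub_re, Complex.ofReal_re, Complex.re_mul_ofReal, Complex.neg_re]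

lemma aux_integrable_real (c : ℝ) : Integrable (fun t : ℝ => Real.exp (-c * t - t ^ 2)) := by
  have := (aux_integrable_s3 (c:ℂ)).norm
  simpa only [aux_norm, Complex.ofReal_re] using this

lemma aux_le (c t : ℝ) (_ : 0 < t) :
    t * Real.exp (-c * t - t ^ 2) ≤ Real.exp (-(c - 1) * t - t ^ 2) := by
  have h1 : t ≤ Real.exp t := by linarith [Real.add_one_le_exp t]
  have h2 : -(c - 1) * t - t ^ 2 = t + (-c * t - t ^ 2) := by ring
  rw [h2, Real.exp_add]
  exact mul_le_mul_of_nonneg_right h1 (Real.exp_pos _).le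

lemma aux_integrable_mul (z : ℂ) :
    IntegrableOn (fun t : ℝ => (t:ℂ) * Complex.exp (-z * t - t ^ 2)) (Ioi 0) := by
  refine Integrable.mono' ((aux_integrable_real (z.re - 1)).integrableOn) ?_ ?_
  · exact Continuous.aestronglyMeasurable (by fun_prop)
  · filter_upwards [ae_restrict_mem measurableSet_Ioi] with t ht
    rw [norm_mul, aux_norm, Complex.norm_real, Real.norm_eq_abs, abs_of_pos ht]
    exact aux_le _ _ ht

/-- the Laplace transform of a Gaussian -/
noncomputable def gG (z : ℂ) : ℂ := ∫ t in Ioi (0:ℝ), Complex.exp (-z * t - t ^ 2)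

lemma gG_ibp (z : ℂ) :
    z * gG z + 2 * ∫ t in Ioi (0:ℝ), (t:ℂ) * Complex.exp (-z * t - t ^ 2) = 1 := by
  have h : ∫ t in Ioi (0:ℝ), ((-z) * Complex.exp (-z * t - t ^ 2)
      + (-2) * ((t:ℂ) * Complex.exp (-z * t - t ^ 2))) =
      0 - Complex.exp (-z * (0:ℝ) - (0:ℝ) ^ 2) := by
    refine integral_Ioi_of_hasDerivAt_of_tendsto
      (f := fun t : ℝ => Complex.exp (-z * t - t ^ 2)) ?_ ?_ ?_ ?_
    · exact (by fun_prop : Continuous fun t : ℝ => Complex.exp (-z * t - t ^ 2)).continuousWithinAt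
    · intro t _
      have h0 : HasDerivAt (fun t : ℝ => (t:ℂ)) 1 t := Complex.ofRealCLM.hasDerivAt
      have h1 : HasDerivAt (fun t : ℝ => -z * (t:ℂ) - (t:ℂ) ^ 2) (-z * 1 - (2:ℕ) * (t:ℂ) ^ 1 * 1) t :=
        (h0.const_mul (-z)).sub (h0.pow 2)
      refine h1.cexp.congr_deriv ?_
      push_cast
      ring
    · exact ((aux_integrable_s3 z).integrableOn.const_mul _).add ((aux_integrable_mul z).const_mul _)
    · rw [tendsto_zero_iff_norm_tendsto_zero]
      simp only [aux_norm]
      refine Real.tendsto_exp_atBot.comp ?_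
      have : ∀ t : ℝ, -z.re * t - t ^ 2 = -(t * (t + z.re)) := fun t => by ring
      simp only [this]
      refine tendsto_neg_atTop_atBot.comp ?_
      exact tendsto_id.atTop_mul_atTop₀ (tendsto_atTop_add_const_right _ _ tendsto_id)
  rw [integral_add ((aux_integrable_s3 z).integrableOn.const_mul _)
    ((aux_integrable_mul z).const_mul _), integral_const_mul, integral_const_mul] at h
  have e0 : Complex.exp (-z * (0:ℝ) - (0:ℝ) ^ 2) = 1 := by simp
  rw [e0] at h
  unfold gG
  linear_combination -h

lemma gG_hasDerivAt (z : ℂ) : HasDerivAt gG ((z * gG z - 1) / 2) z := by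
  have key := hasDerivAt_integral_of_dominated_loc_of_deriv_le (𝕜 := ℂ)
    (μ := volume.restrict (Ioi (0:ℝ)))
    (F := fun z (t:ℝ) => Complex.exp (-z * t - t ^ 2))
    (F' := fun z (t:ℝ) => - ((t:ℂ) * Complex.exp (-z * t - t ^ 2)))
    (bound := fun t => Real.exp (-(z.re - 1 - 1) * t - t ^ 2))
    (x₀ := z) (Metric.ball_mem_nhds z one_pos) ?_ ?_ ?_ ?_ ?_ ?_
  · have h := key.2
    rw [integral_neg] at h
    have e := gG_ibp z
    have : (z * gG z - 1) / 2 = -∫ t in Ioi (0:ℝ), (t:ℂ) * Complex.exp (-z * t - t ^ 2) := by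
      linear_combination e / 2
    rw [this]
    exact h
  · exact Eventually.of_forall fun w => Continuous.aestronglyMeasurable (by fun_prop)
  · exact (aux_integrable_s3 z).integrableOn
  · exact Continuous.aestronglyMeasurable (by fun_prop)
  · filter_upwards [ae_restrict_mem measurableSet_Ioi] with t ht w hw
    have ht : 0 < t := ht
    rw [norm_neg, norm_mul, aux_norm, Complex.norm_real, Real.norm_eq_abs, abs_of_pos ht]
    refine (aux_le _ _ ht).trans ?_
    have h1 : |(w - z).re| ≤ ‖w - z‖ := Complex.abs_re_le_norm _
    have h2 : ‖w - z‖ < 1 := by simpa [dist_eq_norm] using hw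
    rw [Complex.sub_re] at h1
    have h3 := (abs_le.1 (h1.trans h2.le)).1
    apply Real.exp_le_exp.2
    nlinarith
  · exact (aux_integrable_real _).integrableOn
  · refine Eventually.of_forall fun t w _ => ?_
    have h1 : HasDerivAt (fun w : ℂ => -w * (t:ℂ) - (t:ℂ) ^ 2) (-1 * (t:ℂ)) w :=
      ((hasDerivAt_id w).neg.mul_const _).sub_const _
    refine h1.cexp.congr_deriv ?_
    ring

lemma gG_diff : Differentiable ℂ gG := fun z => (gG_hasDerivAt z).differentiableAt

lemma gG_bound (z : ℂ) (hz : 0 ≤ z.re) : ‖gG z‖ ≤ Real.sqrt Real.pi / 2 := by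
  have h : ∫ t in Ioi (0:ℝ), Real.exp (-0 * t - t ^ 2) = Real.sqrt Real.pi / 2 := by
    have := integral_gaussian_Ioi 1
    simpa using this
  rw [← h]
  refine norm_integral_le_of_norm_le (aux_integrable_real 0).integrableOn ?_
  filter_upwards [ae_restrict_mem measurableSet_Ioi] with t ht
  have ht : 0 < t := ht
  rw [aux_norm]
  apply Real.exp_le_exp.2
  nlinarith

/-- `z * g z` -/
noncomputable def kk (z : ℂ) : ℂ := z * gG z

lemma kk_diff : Differentiable ℂ kk := differentiable_id.mul gG_diff

lemma kk_bound : ∃ M : ℝ, 0 ≤ M ∧ ∀ z : ℂ, 0 ≤ z.re → ‖kk z‖ ≤ M := by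
  refine ⟨1 + 2 * ∫ t in Ioi (0:ℝ), Real.exp (-(0 - 1) * t - t ^ 2), ?_, ?_⟩
  · have : 0 ≤ ∫ t in Ioi (0:ℝ), Real.exp (-(0 - 1) * t - t ^ 2) :=
      integral_nonneg fun t => (Real.exp_pos _).le
    linarith
  · intro z hz
    have e : kk z = 1 - 2 * ∫ t in Ioi (0:ℝ), (t:ℂ) * Complex.exp (-z * t - t ^ 2) := by
      have := gG_ibp z
      unfold kk
      linear_combination this
    rw [e]
    refine (norm_sub_le _ _).trans ?_
    rw [norm_one, norm_mul, Complex.norm_ofNat]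
    gcongr
    refine norm_integral_le_of_norm_le (aux_integrable_real (0-1)).integrableOn ?_
    filter_upwards [ae_restrict_mem measurableSet_Ioi] with t ht
    have ht : 0 < t := ht
    rw [norm_mul, aux_norm, Complex.norm_real, Real.norm_eq_abs, abs_of_pos ht]
    refine le_trans ?_ (aux_le _ _ ht)
    gcongr

lemma gG_real (x : ℝ) : gG x = ((∫ t in Ioi (0:ℝ), Real.exp (-x * t - t ^ 2) : ℝ) : ℂ) := by
  rw [← integral_complex_ofReal]
  unfold gG
  congr 1
  ext t
  push_cast
  rfl

lemma gG_imag (y : ℝ) : gG (-(y * Complex.I)) =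
    ((Real.sqrt Real.pi / 2 * Real.exp (-(y ^ 2 / 4)) : ℝ) : ℂ) + (daw (y / 2) : ℝ) * Complex.I := by
  set E : ℝ → ℂ := fun y => (Real.exp (y ^ 2 / 4) : ℝ) with hE
  have hEd : ∀ y : ℝ, HasDerivAt E (((y / 2 * Real.exp (y ^ 2 / 4) : ℝ)) : ℂ) y := by
    intro y
    have : HasDerivAt (fun y : ℝ => Real.exp (y ^ 2 / 4)) (y / 2 * Real.exp (y ^ 2 / 4)) y := by
      have h1 : HasDerivAt (fun y : ℝ => y ^ 2 / 4) ((2:ℕ) * y ^ 1 / 4) y :=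
        (hasDerivAt_pow 2 y).div_const 4
      refine h1.exp.congr_deriv ?_
      push_cast
      ring
    exact this.ofReal_comp
  have hgd : ∀ y : ℝ, HasDerivAt (fun y : ℝ => gG (-(y * Complex.I)))
      (((-(y * Complex.I)) * gG (-(y * Complex.I)) - 1) / 2 * (-Complex.I)) y := by
    intro y
    have h0 : HasDerivAt (fun t : ℝ => -((t:ℂ) * Complex.I)) (-(1 * Complex.I)) y :=
      (Complex.ofRealCLM.hasDerivAt.mul_const Complex.I).neg
    rw [one_mul] at h0
    exact (gG_hasDerivAt _).comp y h0
  have hprod : ∀ y : ℝ, HasDerivAt (fun y : ℝ => E y * gG (-(y * Complex.I)))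
      (Complex.I / 2 * E y) y := by
    intro y
    refine ((hEd y).mul (hgd y)).congr_deriv ?_
    simp only [hE]
    push_cast
    ring_nf
    simp only [Complex.I_sq]
    ring
  have hEc : Continuous E := by
    simp only [hE]
    fun_prop
  have hint := intervalIntegral.integral_eq_sub_of_hasDerivAt (a := 0) (b := y)
    (fun x _ => hprod x) ((hEc.const_mul (Complex.I / 2) : Continuous _).intervalIntegrable _ _)
  have h0 : E 0 * gG (-((0:ℝ) * Complex.I)) = ((Real.sqrt Real.pi / 2 : ℝ) : ℂ) := by
    have h1 : gG ((0:ℝ):ℂ) = ((Real.sqrt Real.pi / 2 : ℝ) : ℂ) := by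
      rw [gG_real]
      congr 1
      have := integral_gaussian_Ioi 1
      simpa using this
    have h2 : E 0 = 1 := by simp [hE]
    have h3 : -(((0:ℝ):ℂ) * Complex.I) = ((0:ℝ):ℂ) := by simp
    rw [h2, h3, h1, one_mul]
  rw [h0, intervalIntegral.integral_const_mul, intervalIntegral.integral_ofReal] at hint
  have hs : ∫ x in (0:ℝ)..y, Real.exp (x ^ 2 / 4) = 2 * ∫ s in (0:ℝ)..(y/2), Real.exp (s ^ 2) := by
    have := intervalIntegral.integral_comp_div (a := 0) (b := y)
      (fun s => Real.exp (s ^ 2)) (c := 2) (by norm_num)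
    simp only [zero_div, smul_eq_mul] at this
    rw [← this]
    congr 1
    ext x
    congr 1
    ring
  rw [hs] at hint
  have hE1 : Real.exp (-(y ^ 2 / 4)) * Real.exp (y ^ 2 / 4) = 1 := by
    rw [← Real.exp_add]; simp
  have hE2 : ((Real.exp (-(y ^ 2 / 4)) : ℝ) : ℂ) * E y = 1 := by
    simp only [hE]
    exact_mod_cast hE1
  have hd : daw (y / 2) = Real.exp (-(y ^ 2 / 4)) * ∫ s in (0:ℝ)..(y/2), Real.exp (s ^ 2) := by
    unfold daw
    congr 2
    ring
  rw [hd]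
  push_cast at hint ⊢
  push_cast at hE2
  linear_combination (-gG (-(y * Complex.I))) * hE2 - Complex.exp (-(y ^ 2 / 4)) * hint

lemma gG_re_nonneg (z : ℂ) (hz : 0 ≤ z.re) (hz' : z.im ≤ 0) : 0 ≤ (gG z).re := by
  have hn : ∀ w : ℂ, ‖Complex.exp (-gG w)‖ = Real.exp (-(gG w).re) := fun w => by
    rw [Complex.norm_exp, Complex.neg_re]
  have h : ‖Complex.exp (-gG z)‖ ≤ 1 := by
    refine PhragmenLindelof.quadrant_IV (f := fun w => Complex.exp (-gG w)) (z := z) ?_ ?_ ?_ ?_ hz hz'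
    · exact (gG_diff.neg.cexp).diffContOnCl
    · refine ⟨1, by norm_num, 0, ?_⟩
      refine Asymptotics.IsBigO.of_bound (Real.exp (Real.sqrt Real.pi / 2)) ?_
      refine mem_inf_of_right ?_
      rintro w ⟨hw, _⟩
      have hw : 0 < w.re := hw
      simp only [mem_ofPred_eq, zero_mul, Real.exp_zero, norm_one, mul_one, hn]
      apply Real.exp_le_exp.2
      have h1 := gG_bound w hw.le
      have h2 := (abs_le.1 ((Complex.abs_re_le_norm _).trans h1)).1
      linarith
    · intro x _
      rw [hn, gG_real, Complex.ofReal_re]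
      apply Real.exp_le_one_iff.2
      have : 0 ≤ ∫ t in Ioi (0:ℝ), Real.exp (-x * t - t ^ 2) :=
        integral_nonneg fun t => (Real.exp_pos _).le
      linarith
    · intro x _
      have : (x:ℂ) * Complex.I = -(((-x : ℝ) : ℂ) * Complex.I) := by push_cast; ring
      rw [hn, this, gG_imag]
      apply Real.exp_le_one_iff.2
      simp only [Complex.add_re, Complex.ofReal_re, Complex.re_ofReal_mul, Complex.I_re, mul_zero,
        add_zero]
      have : 0 ≤ Real.sqrt Real.pi / 2 * Real.exp (-((-x) ^ 2 / 4)) := by positivity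
      linarith
  rw [hn, Real.exp_le_one_iff] at h
  linarith

/-- closed fourth quadrant -/
def Q4 : Set ℂ := {s | 0 ≤ s.re ∧ s.im ≤ 0}

/-- `s` times the Laplace transform of the kernel -/
noncomputable def LL (μ : Measure ℝ) (s : ℂ) : ℂ :=
  ∫ x in Ici (0:ℝ), kk (s / ((Real.sqrt x : ℝ) : ℂ)) ∂μ

lemma LL_zero (μ : Measure ℝ) : LL μ 0 = 0 := by
  simp [LL, kk]

lemma meas_div (s : ℂ) : Measurable (fun x : ℝ => s / ((Real.sqrt x : ℝ) : ℂ)) := by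
  fun_prop

lemma kk_meas (μ : Measure ℝ) (s : ℂ) :
    AEStronglyMeasurable (fun x : ℝ => kk (s / ((Real.sqrt x : ℝ) : ℂ))) μ :=
  (kk_diff.continuous.measurable.comp (meas_div s)).aestronglyMeasurable

lemma kk_dom : ∃ M C : ℝ, 0 ≤ M ∧ 0 ≤ C ∧ ∀ s : ℂ, 0 ≤ s.re → ∀ x : ℝ, 0 ≤ x →
    ‖kk (s / ((Real.sqrt x : ℝ) : ℂ))‖ ≤ M * (Icc (0:ℝ) 1).indicator (fun _ => (1:ℝ)) x +
      C * ‖s‖ * (Ici (1:ℝ)).indicator (fun x => 1 / Real.sqrt x) x := by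
  obtain ⟨M, hM, h⟩ := kk_bound
  refine ⟨M, Real.sqrt Real.pi / 2, hM, by positivity, fun s hs x hx => ?_⟩
  have hre : 0 ≤ (s / ((Real.sqrt x : ℝ) : ℂ)).re := by
    rw [Complex.div_ofReal_re]
    positivity
  by_cases hx1 : x ≤ 1
  · rw [indicator_of_mem (show x ∈ Icc (0:ℝ) 1 from ⟨hx, hx1⟩), mul_one]
    have : 0 ≤ (Ici (1:ℝ)).indicator (fun x => 1 / Real.sqrt x) x :=
      indicator_nonneg (fun y _ => by positivity) x
    have h2 := h _ hre
    have : 0 ≤ Real.sqrt Real.pi / 2 * ‖s‖ * (Ici (1:ℝ)).indicator (fun x => 1 / Real.sqrt x) x := by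
      positivity
    linarith
  · rw [indicator_of_notMem (fun h => hx1 h.2), indicator_of_mem (show x ∈ Ici (1:ℝ) from
      (not_le.1 hx1).le), mul_zero, zero_add]
    unfold kk
    rw [norm_mul, norm_div, Complex.norm_real, Real.norm_eq_abs, abs_of_nonneg (Real.sqrt_nonneg x)]
    have := gG_bound _ hre
    calc _ ≤ ‖s‖ / Real.sqrt x * (Real.sqrt Real.pi / 2) := by gcongr
      _ = _ := by ring

section
variable {μ : Measure ℝ}

lemma dom_int (hμ01 : μ (Icc (0:ℝ) 1) < ⊤)
    (hμint : IntegrableOn (fun x : ℝ => 1 / Real.sqrt x) (Ici 1) μ) (a b : ℝ) :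
    Integrable (fun x => a * (Icc (0:ℝ) 1).indicator (fun _ => (1:ℝ)) x +
      b * (Ici (1:ℝ)).indicator (fun x => 1 / Real.sqrt x) x) (μ.restrict (Ici 0)) := by
  refine Integrable.add (Integrable.const_mul ?_ _) (Integrable.const_mul ?_ _)
  · refine Integrable.restrict ?_
    rw [integrable_indicator_iff measurableSet_Icc]
    exact integrableOn_const hμ01.ne
  · refine Integrable.restrict ?_
    rwa [integrable_indicator_iff measurableSet_Ici]

lemma LL_int (hμ01 : μ (Icc (0:ℝ) 1) < ⊤)
    (hμint : IntegrableOn (fun x : ℝ => 1 / Real.sqrt x) (Ici 1) μ) (s : ℂ) (hs : 0 ≤ s.re) :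
    IntegrableOn (fun x : ℝ => kk (s / ((Real.sqrt x : ℝ) : ℂ))) (Ici 0) μ := by
  obtain ⟨M, C, hM, hC, h⟩ := kk_dom
  refine Integrable.mono' (dom_int hμ01 hμint M (C * ‖s‖)) (kk_meas _ _) ?_
  filter_upwards [ae_restrict_mem measurableSet_Ici] with x hx
  exact h s hs x hx

lemma LL_bound (hμ01 : μ (Icc (0:ℝ) 1) < ⊤)
    (hμint : IntegrableOn (fun x : ℝ => 1 / Real.sqrt x) (Ici 1) μ) :
    ∃ A B : ℝ, ∀ s : ℂ, 0 ≤ s.re → ‖LL μ s‖ ≤ A + B * ‖s‖ := by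
  obtain ⟨M, C, hM, hC, h⟩ := kk_dom
  refine ⟨∫ x in Ici (0:ℝ), (M * (Icc (0:ℝ) 1).indicator (fun _ => (1:ℝ)) x +
      0 * (Ici (1:ℝ)).indicator (fun x => 1 / Real.sqrt x) x) ∂μ,
    ∫ x in Ici (0:ℝ), (0 * (Icc (0:ℝ) 1).indicator (fun _ => (1:ℝ)) x +
      C * (Ici (1:ℝ)).indicator (fun x => 1 / Real.sqrt x) x) ∂μ, fun s hs => ?_⟩
  rw [← integral_mul_const, ← integral_add (dom_int hμ01 hμint M 0)
    ((dom_int hμ01 hμint 0 C).mul_const _)]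
  refine norm_integral_le_of_norm_le ((dom_int hμ01 hμint M 0).add
    ((dom_int hμ01 hμint 0 C).mul_const _)) ?_
  filter_upwards [ae_restrict_mem measurableSet_Ici] with x hx
  refine (h s hs x hx).trans (le_of_eq ?_)
  ring

lemma LL_cont (hμ01 : μ (Icc (0:ℝ) 1) < ⊤)
    (hμint : IntegrableOn (fun x : ℝ => 1 / Real.sqrt x) (Ici 1) μ) :
    ContinuousOn (LL μ) Q4 := by
  obtain ⟨M, C, hM, hC, h⟩ := kk_dom
  intro s hs
  refine continuousWithinAt_of_dominated
    (bound := fun x => M * (Icc (0:ℝ) 1).indicator (fun _ => (1:ℝ)) x +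
      C * (‖s‖ + 1) * (Ici (1:ℝ)).indicator (fun x => 1 / Real.sqrt x) x)
    (Eventually.of_forall fun w => kk_meas _ _) ?_ (dom_int hμ01 hμint _ _) ?_
  · have h1 : ∀ᶠ w in nhdsWithin s Q4, ‖w‖ < ‖s‖ + 1 :=
      (continuous_norm.continuousWithinAt.eventually_lt_const (by linarith))
    filter_upwards [self_mem_nhdsWithin, h1] with w hw hw1
    filter_upwards [ae_restrict_mem measurableSet_Ici] with x hx
    refine (h w hw.1 x hx).trans ?_
    have : 0 ≤ (Ici (1:ℝ)).indicator (fun x => 1 / Real.sqrt x) x :=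
      indicator_nonneg (fun y _ => by positivity) x
    gcongr
  · refine Eventually.of_forall fun x => Continuous.continuousWithinAt ?_
    exact kk_diff.continuous.comp (continuous_id.div_const _)

lemma LL_diff (hμ01 : μ (Icc (0:ℝ) 1) < ⊤)
    (hμint : IntegrableOn (fun x : ℝ => 1 / Real.sqrt x) (Ici 1) μ) (s : ℂ) (hs : 0 < s.re) :
    DifferentiableAt ℂ (LL μ) s := by
  obtain ⟨M, C, hM, hC, h⟩ := kk_dom
  set r := s.re / 2 with hr
  have hr0 : 0 < r := by positivity
  have hF : ∀ (x : ℝ) (w : ℂ), HasDerivAt (fun w => kk (w / ((Real.sqrt x : ℝ) : ℂ)))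
      (deriv kk (w / ((Real.sqrt x : ℝ) : ℂ)) * (1 / ((Real.sqrt x : ℝ) : ℂ))) w := fun x w =>
    (kk_diff _).hasDerivAt.comp w ((hasDerivAt_id w).div_const _)
  have key := hasDerivAt_integral_of_dominated_loc_of_deriv_le (𝕜 := ℂ)
    (μ := μ.restrict (Ici (0:ℝ)))
    (F := fun w (x:ℝ) => kk (w / ((Real.sqrt x : ℝ) : ℂ)))
    (F' := fun w (x:ℝ) => deriv kk (w / ((Real.sqrt x : ℝ) : ℂ)) * (1 / ((Real.sqrt x : ℝ) : ℂ)))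
    (bound := fun x => (M * (Icc (0:ℝ) 1).indicator (fun _ => (1:ℝ)) x +
      C * (‖s‖ + 2 * r) * (Ici (1:ℝ)).indicator (fun x => 1 / Real.sqrt x) x) / r)
    (x₀ := s) (Metric.ball_mem_nhds s hr0) ?_ ?_ ?_ ?_ ?_ ?_
  · exact key.2.differentiableAt
  · exact Eventually.of_forall fun w => kk_meas _ _
  · exact LL_int hμ01 hμint s hs.le
  · refine Measurable.aestronglyMeasurable (Measurable.mul ?_ (meas_div 1))
    exact (measurable_deriv kk).comp (meas_div s)
  · filter_upwards [ae_restrict_mem measurableSet_Ici] with x hx w hw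
    rw [← (hF x w).deriv]
    refine Complex.norm_deriv_le_of_forall_mem_sphere_norm_le hr0 ?_ ?_
    · exact Differentiable.diffContOnCl fun w => (hF x w).differentiableAt
    · intro v hv
      have h1 : ‖v - s‖ ≤ 2 * r := by
        have e1 : ‖w - s‖ < r := by simpa [dist_eq_norm] using hw
        have e2 : ‖v - w‖ = r := by simpa [dist_eq_norm] using hv
        have : v - s = (v - w) + (w - s) := by ring
        rw [this]
        refine (norm_add_le _ _).trans ?_
        linarith
      have h2 : 0 ≤ v.re := by
        have := (abs_le.1 ((Complex.abs_re_le_norm _).trans h1)).1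
        rw [Complex.sub_re] at this
        linarith
      have h3 : ‖v‖ ≤ ‖s‖ + 2 * r := by
        have : v = s + (v - s) := by ring
        rw [this]
        refine (norm_add_le _ _).trans ?_
        linarith
      refine (h v h2 x hx).trans ?_
      have : 0 ≤ (Ici (1:ℝ)).indicator (fun x => 1 / Real.sqrt x) x :=
        indicator_nonneg (fun y _ => by positivity) x
      gcongr
  · exact (dom_int hμ01 hμint _ _).div_const _
  · exact Eventually.of_forall fun x w _ => hF x w

lemma LL_div (s : ℂ) (hs0 : s ≠ 0) :
    LL μ s / s = ∫ x in Ici (0:ℝ), ((1 / Real.sqrt x : ℝ) : ℂ) * gG (s / ((Real.sqrt x : ℝ) : ℂ)) ∂μ := by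
  unfold LL
  rw [← integral_div]
  congr 1
  ext x
  unfold kk
  push_cast
  field_simp

lemma LL_div_int (hμ01 : μ (Icc (0:ℝ) 1) < ⊤)
    (hμint : IntegrableOn (fun x : ℝ => 1 / Real.sqrt x) (Ici 1) μ) (s : ℂ) (hs : 0 ≤ s.re)
    (hs0 : s ≠ 0) : IntegrableOn
      (fun x : ℝ => ((1 / Real.sqrt x : ℝ) : ℂ) * gG (s / ((Real.sqrt x : ℝ) : ℂ))) (Ici 0) μ := by
  refine ((LL_int hμ01 hμint s hs).div_const s).congr (Eventually.of_forall fun x => ?_)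
  simp only
  unfold kk
  push_cast
  field_simp

lemma LL_re (hμ01 : μ (Icc (0:ℝ) 1) < ⊤)
    (hμint : IntegrableOn (fun x : ℝ => 1 / Real.sqrt x) (Ici 1) μ) (s : ℂ) (hs : s ∈ Q4)
    (hs0 : s ≠ 0) : 0 ≤ (LL μ s / s).re := by
  rw [LL_div s hs0]
  refine le_of_le_of_eq ?_ (integral_re (𝕜 := ℂ) (LL_div_int hμ01 hμint s hs.1 hs0))
  refine integral_nonneg fun x => ?_
  change 0 ≤ (((1 / Real.sqrt x : ℝ) : ℂ) * gG (s / ((Real.sqrt x : ℝ) : ℂ))).re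
  rw [Complex.re_ofReal_mul]
  refine mul_nonneg (by positivity) (gG_re_nonneg _ ?_ ?_)
  · rw [Complex.div_ofReal_re]
    exact div_nonneg hs.1 (Real.sqrt_nonneg _)
  · rw [Complex.div_ofReal_im]
    exact div_nonpos_of_nonpos_of_nonneg hs.2 (Real.sqrt_nonneg _)

lemma LL_real (s : ℝ) : (LL μ s).im = 0 := by
  have : LL μ s = ((∫ x in Ici (0:ℝ), (s / Real.sqrt x) *
      (∫ t in Ioi (0:ℝ), Real.exp (-(s / Real.sqrt x) * t - t ^ 2)) ∂μ : ℝ) : ℂ) := by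
    rw [← integral_complex_ofReal]
    unfold LL
    congr 1
    ext x
    unfold kk
    rw [← Complex.ofReal_div, gG_real, ← Complex.ofReal_mul]
  rw [this, Complex.ofReal_im]

lemma LL_imag (hμ01 : μ (Icc (0:ℝ) 1) < ⊤)
    (hμint : IntegrableOn (fun x : ℝ => 1 / Real.sqrt x) (Ici 1) μ)
    (ω : ℝ) (hω : 0 < ω) : LL μ (-(ω * Complex.I)) = -(ω * Complex.I) *
      (((Real.sqrt Real.pi / 2 *
        ∫ x in Ici (0:ℝ), (1 / Real.sqrt x) * Real.exp (-(ω ^ 2 / (4 * x))) ∂μ : ℝ) : ℂ) +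
      ((∫ x in Ici (0:ℝ), (1 / Real.sqrt x) * daw (ω / (2 * Real.sqrt x)) ∂μ : ℝ) : ℂ)
        * Complex.I) := by
  have hs0 : -((ω:ℂ) * Complex.I) ≠ 0 := by simp [hω.ne']
  have hi := LL_div_int hμ01 hμint (-(ω * Complex.I)) (by simp) hs0
  have e := integral_re_add_im (𝕜 := ℂ) hi
  have hd := LL_div (μ := μ) _ hs0
  rw [← e] at hd
  have hpt : ∀ x : ℝ, 0 ≤ x →
      ((1 / Real.sqrt x : ℝ) : ℂ) * gG (-(ω * Complex.I) / ((Real.sqrt x : ℝ) : ℂ)) =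
      ((Real.sqrt Real.pi / 2 * ((1 / Real.sqrt x) * Real.exp (-(ω ^ 2 / (4 * x)))) : ℝ) : ℂ) +
      ((1 / Real.sqrt x) * daw (ω / (2 * Real.sqrt x)) : ℝ) * Complex.I := by
    intro x hx
    have h1 : -(ω * Complex.I) / ((Real.sqrt x : ℝ) : ℂ)
      = -(((ω / Real.sqrt x : ℝ) : ℂ) * Complex.I) := by push_cast; ring
    have h2 : (ω / Real.sqrt x) ^ 2 / 4 = ω ^ 2 / (4 * x) := by
      rw [div_pow, Real.sq_sqrt hx, div_div, mul_comm]
    have h3 : ω / Real.sqrt x / 2 = ω / (2 * Real.sqrt x) := by rw [div_div, mul_comm]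
    rw [h1, gG_imag, h2, h3]
    push_cast
    ring
  rw [← integral_const_mul]
  rw [div_eq_iff hs0] at hd
  rw [hd, mul_comm]
  congr 1
  have i1 : ∀ F G : ℝ → ℝ, (∀ x, 0 ≤ x → F x = G x) →
      ∫ x in Ici (0:ℝ), F x ∂μ = ∫ x in Ici (0:ℝ), G x ∂μ := fun F G hFG =>
    setIntegral_congr_fun measurableSet_Ici fun x hx => hFG x hx
  congr 1
  · congr 1
    apply i1
    intro x hx
    rw [hpt x hx]
    simp [-Complex.ofReal_mul, -Complex.ofReal_div]
  · congr 2
    apply i1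
    intro x hx
    rw [hpt x hx]
    simp [-Complex.ofReal_mul, -Complex.ofReal_div]

end

lemma vert_tendsto (F : ℂ → ℂ) (hF : ContinuousOn F (univ ×ℂ Icc (-(Real.pi / 2)) 0)) (c : ℂ)
    (l : ℕ → ℝ) (lf : Filter ℝ) (hl : Tendsto l atTop lf)
    (h : Tendsto F (comap Complex.re lf ⊓ 𝓟 (univ ×ℂ Icc (-(Real.pi / 2)) 0)) (nhds c)) :
    Tendsto (fun n => ∫ y in (-(Real.pi / 2))..0, F (l n + y * Complex.I)) atTop
      (nhds ((Real.pi / 2) * c)) := by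
  have hpi := Real.pi_pos
  have hle : -(Real.pi / 2) ≤ 0 := by linarith
  have hI : (Real.pi / 2 : ℂ) * c = ∫ y in (-(Real.pi / 2))..0, c := by
    rw [intervalIntegral.integral_const, Complex.real_smul]
    push_cast
    ring
  rw [hI]
  have hpt : ∀ y ∈ Ioc (-(Real.pi / 2)) 0, ∀ u : ℝ,
      (u + y * Complex.I : ℂ) ∈ univ ×ℂ Icc (-(Real.pi / 2)) 0 := by
    intro y hy u
    rw [Complex.mem_reProdIm]
    simp [hy.1.le, hy.2]
  have hev : ∀ᶠ z in comap Complex.re lf ⊓ 𝓟 (univ ×ℂ Icc (-(Real.pi / 2)) 0),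
      ‖F z‖ < ‖c‖ + 1 := h.norm.eventually_lt_const (by linarith)
  rw [eventually_inf_principal, eventually_comap] at hev
  refine intervalIntegral.tendsto_integral_filter_of_dominated_convergence (fun _ => ‖c‖ + 1)
    ?_ ?_ ?_ ?_
  · refine Eventually.of_forall fun n => ?_
    rw [uIoc_of_le hle]
    refine ContinuousOn.aestronglyMeasurable ?_ measurableSet_Ioc
    refine hF.comp (by fun_prop) fun y hy => hpt y hy _
  · filter_upwards [hl.eventually hev] with n hn
    refine Eventually.of_forall fun y hy => ?_
    rw [uIoc_of_le hle] at hy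
    exact (hn (l n + y * Complex.I) (by simp) (hpt y hy _)).le
  · exact intervalIntegrable_const
  · refine Eventually.of_forall fun y hy => ?_
    rw [uIoc_of_le hle] at hy
    refine h.comp ?_
    refine tendsto_inf.2 ⟨?_, ?_⟩
    · rw [tendsto_comap_iff]
      refine hl.congr fun n => ?_
      simp
    · exact tendsto_principal.2 (Eventually.of_forall fun n => hpt y hy _)

lemma strip (F : ℂ → ℂ) (hF : ContinuousOn F (univ ×ℂ Icc (-(Real.pi / 2)) 0))
    (hd : DifferentiableOn ℂ F (univ ×ℂ Ioo (-(Real.pi / 2)) 0)) (c : ℝ)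
    (hr : ∀ u : ℝ, (F u).im = 0)
    (h0 : Tendsto F (comap Complex.re atBot ⊓ 𝓟 (univ ×ℂ Icc (-(Real.pi / 2)) 0)) (nhds 0))
    (h1 : Tendsto F (comap Complex.re atTop ⊓ 𝓟 (univ ×ℂ Icc (-(Real.pi / 2)) 0)) (nhds c))
    (hneg : ∀ u : ℝ, (F (u + (-(Real.pi / 2) : ℝ) * Complex.I)).im ≤ 0) :
    ∫ u : ℝ, -(F (u + (-(Real.pi / 2) : ℝ) * Complex.I)).im = Real.pi / 2 * c := by
  have hpi := Real.pi_pos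
  have hle : -(Real.pi / 2) ≤ 0 := by linarith
  have hln : Tendsto (fun n : ℕ => (n:ℝ)) atTop atTop := tendsto_natCast_atTop_atTop
  have hlm : Tendsto (fun n : ℕ => -(n:ℝ)) atTop atBot := tendsto_neg_atTop_atBot.comp hln
  have v1 := vert_tendsto F hF c _ _ hln h1
  have v0 := vert_tendsto F hF 0 _ _ hlm h0
  have hcb : Continuous fun u : ℝ => F (u + (-(Real.pi / 2) : ℝ) * Complex.I) := by
    rw [← continuousOn_univ]
    refine hF.comp (by fun_prop) fun u _ => ?_
    rw [Complex.mem_reProdIm]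
    simp
    linarith
  have hct : Continuous fun u : ℝ => F (u + (0 : ℝ) * Complex.I) := by
    rw [← continuousOn_univ]
    refine hF.comp (by fun_prop) fun u _ => ?_
    rw [Complex.mem_reProdIm]
    simp
    linarith
  have hci : Continuous fun u : ℝ => -(F (u + (-(Real.pi / 2) : ℝ) * Complex.I)).im :=
    (Complex.continuous_im.comp hcb).neg
  have hrect : ∀ n : ℕ, ∫ u in (-(n:ℝ))..n, -(F (u + (-(Real.pi / 2) : ℝ) * Complex.I)).im =
      (∫ y in (-(Real.pi / 2))..0, F ((n:ℝ) + y * Complex.I)).re -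
      (∫ y in (-(Real.pi / 2))..0, F ((-(n:ℝ) : ℝ) + y * Complex.I)).re := by
    intro n
    have hn : -(n:ℝ) ≤ n := by linarith [(Nat.cast_nonneg n : (0:ℝ) ≤ n)]
    have H := Complex.integral_boundary_rect_eq_zero_of_continuousOn_of_differentiableOn F
      (⟨-(n:ℝ), -(Real.pi / 2)⟩ : ℂ) (⟨n, 0⟩ : ℂ) ?_ ?_
    · simp only at H
      have H2 := congrArg Complex.im H
      have i1 : (∫ u in (-(n:ℝ))..n, F (u + (-(Real.pi / 2) : ℝ) * Complex.I)).im =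
          ∫ u in (-(n:ℝ))..n, (F (u + (-(Real.pi / 2) : ℝ) * Complex.I)).im :=
        (Complex.imCLM.intervalIntegral_comp_comm (hcb.intervalIntegrable _ _)).symm
      have i2 : (∫ u in (-(n:ℝ))..n, F (u + (0 : ℝ) * Complex.I)).im = 0 := by
        refine (Complex.imCLM.intervalIntegral_comp_comm (hct.intervalIntegrable _ _)).symm.trans ?_
        have : ∀ u : ℝ, Complex.imCLM (F (u + (0 : ℝ) * Complex.I)) = 0 := fun u => by
          simpa using hr u
        simp only [this, intervalIntegral.integral_zero]
      rw [Complex.sub_im, Complex.add_im, Complex.sub_im, i1, i2, smul_eq_mul, smul_eq_mul,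
        Complex.I_mul_im, Complex.I_mul_im, Complex.zero_im] at H2
      rw [intervalIntegral.integral_neg]
      linarith
    · refine hF.mono ?_
      rintro z ⟨_, hz⟩
      refine ⟨mem_univ _, ?_⟩
      simpa [uIcc_of_le hle] using hz
    · refine hd.mono ?_
      rintro z ⟨_, hz⟩
      refine ⟨mem_univ _, ?_⟩
      simpa [min_eq_left hle, max_eq_right hle] using hz
  have hlim : Tendsto (fun n : ℕ => ∫ u in (-(n:ℝ))..n,
      -(F (u + (-(Real.pi / 2) : ℝ) * Complex.I)).im) atTop (nhds (Real.pi / 2 * c)) := by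
    simp only [hrect]
    have := ((Complex.continuous_re.tendsto _).comp v1).sub ((Complex.continuous_re.tendsto _).comp v0)
    have e : (Real.pi / 2 * c : ℂ) = ((Real.pi / 2 * c : ℝ) : ℂ) := by push_cast; rfl
    rw [e, Complex.ofReal_re, mul_zero, Complex.zero_re, sub_zero] at this
    exact this
  refine (aecover_Ioc hlm hln).integral_eq_of_tendsto_of_nonneg_ae _ ?_ ?_ ?_
  · exact Eventually.of_forall fun u => by simpa using hneg u
  · intro n
    exact hci.integrableOn_Ioc
  · refine hlim.congr fun n => ?_
    rw [intervalIntegral.integral_of_le]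
    linarith [(Nat.cast_nonneg n : (0:ℝ) ≤ n)]

lemma exp_mem_Q4 (z : ℂ) (hz : z ∈ univ ×ℂ Icc (-(Real.pi / 2)) 0) : Complex.exp z ∈ Q4 := by
  obtain ⟨_, hz⟩ := hz
  have hz : z.im ∈ Icc (-(Real.pi / 2)) 0 := hz
  constructor
  · rw [Complex.exp_re]
    exact mul_nonneg (Real.exp_pos _).le (Real.cos_nonneg_of_mem_Icc ⟨hz.1, by linarith [hz.2, Real.pi_pos]⟩)
  · rw [Complex.exp_im]
    exact mul_nonpos_of_nonneg_of_nonpos (Real.exp_pos _).le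
      (Real.sin_nonpos_of_nonpos_of_neg_pi_le hz.2 (by linarith [hz.1, Real.pi_pos]))

lemma quadrant (P : ℂ → ℂ) (hP : ContinuousOn P Q4)
    (hd : ∀ s : ℂ, 0 < s.re → s.im < 0 → DifferentiableAt ℂ P s) (c : ℝ)
    (hr : ∀ u : ℝ, 0 < u → (P u).im = 0) (h0 : P 0 = 0)
    (h1 : Tendsto P (Bornology.cobounded ℂ ⊓ 𝓟 Q4) (nhds c))
    (hneg : ∀ ω : ℝ, 0 < ω → (P (-(ω * Complex.I))).im ≤ 0) :
    ∫ ω in Ioi (0:ℝ), -(P (-(ω * Complex.I))).im / ω = Real.pi / 2 * c := by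
  have hexp : ∀ u : ℝ, Complex.exp (u + (-(Real.pi / 2) : ℝ) * Complex.I) =
      -((Real.exp u : ℝ) * Complex.I) := by
    intro u
    rw [Complex.exp_add]
    have : ((-(Real.pi / 2) : ℝ) : ℂ) * Complex.I = -(Real.pi / 2 * Complex.I) := by
      push_cast; ring
    rw [this, Complex.exp_neg, Complex.exp_pi_div_two_mul_I, Complex.inv_I]
    push_cast
    ring
  have hs := strip (fun z => P (Complex.exp z)) ?_ ?_ c ?_ ?_ ?_ ?_
  · rw [← Real.range_exp, ← image_univ, integral_image_eq_integral_abs_deriv_smul MeasurableSet.univ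
      (fun x _ => (Real.hasDerivAt_exp x).hasDerivWithinAt) Real.exp_injective.injOn, ← hs,
      setIntegral_univ]
    congr 1
    ext u
    rw [hexp, abs_of_pos (Real.exp_pos u), smul_eq_mul]
    have := (Real.exp_pos u).ne'
    field_simp
  · exact hP.comp Complex.continuous_exp.continuousOn fun z hz => exp_mem_Q4 z hz
  · rintro z ⟨_, hz⟩
    have hz : z.im ∈ Ioo (-(Real.pi / 2)) 0 := hz
    refine DifferentiableAt.differentiableWithinAt ?_
    refine (hd _ ?_ ?_).comp z Complex.differentiable_exp.differentiableAt
    · rw [Complex.exp_re]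
      exact mul_pos (Real.exp_pos _) (Real.cos_pos_of_mem_Ioo ⟨hz.1, by linarith [hz.2, Real.pi_pos]⟩)
    · rw [Complex.exp_im]
      exact mul_neg_of_pos_of_neg (Real.exp_pos _)
        (Real.sin_neg_of_neg_of_neg_pi_lt hz.2 (by linarith [hz.1, Real.pi_pos]))
  · intro u
    rw [← Complex.ofReal_exp]
    exact hr _ (Real.exp_pos u)
  · have hc := hP 0 (by simp [Q4])
    unfold ContinuousWithinAt at hc
    rw [h0] at hc
    refine hc.comp (tendsto_inf.2 ⟨?_, ?_⟩)
    · rw [tendsto_zero_iff_norm_tendsto_zero]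
      simp only [Complex.norm_exp]
      exact (Real.tendsto_exp_atBot.comp tendsto_comap).mono_left inf_le_left
    · exact tendsto_principal.2 (mem_inf_of_right fun z hz => exp_mem_Q4 z hz)
  · refine h1.comp (tendsto_inf.2 ⟨?_, ?_⟩)
    · rw [← tendsto_norm_atTop_iff_cobounded]
      simp only [Complex.norm_exp]
      exact (Real.tendsto_exp_atTop.comp tendsto_comap).mono_left inf_le_left
    · exact tendsto_principal.2 (mem_inf_of_right fun z hz => exp_mem_Q4 z hz)
  · intro u
    simp only [hexp]
    exact hneg _ (Real.exp_pos u)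

set_option maxHeartbeats 1000000 in
/-- Equipartition of energy for the harmonically bounded GLE with memory kernel
`K(t) = φ(t²) = ∫₀^∞ e^{-t²x} μ(dx)`, `φ` completely monotonic:
`∫₀^∞ r₁₁(ω) dω = π/γ` and `∫₀^∞ ω² r₁₁(ω) dω = π/m`. -/
theorem equipartition_harmonic_gaussian_type_kernel
    (μ : Measure ℝ) (m lam β γ : ℝ)
    (hm : 0 < m) (hlam : 0 < lam) (hβ : 0 < β) (hγ : 0 < γ)
    (hμ0 : μ {0} = 0)
    (hμ01 : μ (Icc (0:ℝ) 1) < ⊤)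
    (hμint : IntegrableOn (fun x : ℝ => 1 / Real.sqrt x) (Ici 1) μ)
    (Kcos Ksin : ℝ → ℝ)
    (hKcos : ∀ ω > 0, Kcos ω =
      Real.sqrt Real.pi / 2 *
        ∫ x in Ici (0:ℝ), (1 / Real.sqrt x) * Real.exp (-(ω ^ 2 / (4 * x))) ∂μ)
    (hKsin : ∀ ω > 0, Ksin ω =
      ∫ x in Ici (0:ℝ), (1 / Real.sqrt x) * daw (ω / (2 * Real.sqrt x)) ∂μ)
    (r11 : ℝ → ℝ)
    (hr11 : ∀ ω > 0, r11 ω =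
      2 * (lam + β * Kcos ω) /
        ((γ - m * ω ^ 2 + β * ω * Ksin ω) ^ 2 + ω ^ 2 * (lam + β * Kcos ω) ^ 2)) :
    (∫ ω in Ioi (0:ℝ), r11 ω = Real.pi / γ) ∧
    (∫ ω in Ioi (0:ℝ), ω ^ 2 * r11 ω = Real.pi / m) := by
  set D : ℂ → ℂ := fun s => m * s ^ 2 + lam * s + β * LL μ s + γ with hD
  have hD0 : D 0 = γ := by simp [hD, LL_zero]
  have hDc : ContinuousOn D Q4 := by
    have := LL_cont hμ01 hμint
    simp only [hD]
    fun_prop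
  have hDd : ∀ s : ℂ, 0 < s.re → DifferentiableAt ℂ D s := by
    intro s hs
    have := LL_diff hμ01 hμint s hs
    simp only [hD]
    fun_prop
  have hDne : ∀ s ∈ Q4, D s ≠ 0 := by
    intro s hs h
    by_cases hs0 : s = 0
    · rw [hs0, hD0] at h
      exact hγ.ne' (by exact_mod_cast h)
    · have e : D s / s = m * s + lam + β * (LL μ s / s) + γ * s⁻¹ := by
        simp only [hD]
        field_simp
      have e2 := congrArg Complex.re e
      rw [h, zero_div] at e2
      simp only [Complex.zero_re, Complex.add_re, Complex.re_ofReal_mul, Complex.ofReal_re] at e2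
      have h1 := LL_re hμ01 hμint s hs hs0
      have h2 : 0 ≤ (s⁻¹).re := by
        rw [Complex.inv_re]
        exact div_nonneg hs.1 (Complex.normSq_nonneg _)
      have h3 := hs.1
      have : 0 < m * s.re + lam + β * (LL μ s / s).re + γ * (s⁻¹).re := by positivity
      linarith
  have hDreal : ∀ u : ℝ, (D u).im = 0 := by
    intro u
    have h1 : (u:ℂ) ^ 2 = ((u ^ 2 : ℝ) : ℂ) := by push_cast; rfl
    simp only [hD, h1, Complex.add_im, Complex.im_ofReal_mul, Complex.ofReal_im, LL_real]
    simp
  have hDr : ∀ u : ℝ, D u = (((D u).re : ℝ) : ℂ) := by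
    intro u
    apply Complex.ext <;> simp [hDreal]
  have hcob : Tendsto (fun s : ℂ => ‖s‖) (Bornology.cobounded ℂ ⊓ 𝓟 Q4) atTop :=
    tendsto_norm_cobounded_atTop.mono_left inf_le_left
  have hne : ∀ᶠ s : ℂ in Bornology.cobounded ℂ ⊓ 𝓟 Q4, s ≠ 0 := by
    filter_upwards [hcob.eventually_gt_atTop 0] with s hs
    exact norm_pos_iff.1 hs
  have hinv : Tendsto (fun s : ℂ => s⁻¹) (Bornology.cobounded ℂ ⊓ 𝓟 Q4) (nhds 0) :=
    tendsto_inv₀_cobounded.mono_left inf_le_left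
  have hlimD : Tendsto (fun s : ℂ => D s / s ^ 2) (Bornology.cobounded ℂ ⊓ 𝓟 Q4) (nhds m) := by
    obtain ⟨A, B, hAB⟩ := LL_bound hμ01 hμint
    have hL : Tendsto (fun s : ℂ => LL μ s * (s⁻¹) ^ 2) (Bornology.cobounded ℂ ⊓ 𝓟 Q4) (nhds 0) := by
      rw [tendsto_zero_iff_norm_tendsto_zero]
      have hb : Tendsto (fun s : ℂ => A * ‖s⁻¹‖ ^ 2 + B * ‖s⁻¹‖) (Bornology.cobounded ℂ ⊓ 𝓟 Q4)
          (nhds (A * 0 ^ 2 + B * 0)) := by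
        have h1 : Tendsto (fun s : ℂ => ‖s⁻¹‖) (Bornology.cobounded ℂ ⊓ 𝓟 Q4) (nhds 0) := by
          simpa using hinv.norm
        exact ((h1.pow 2).const_mul A).add (h1.const_mul B)
      rw [show A * 0 ^ 2 + B * 0 = (0:ℝ) by ring] at hb
      refine squeeze_zero' (Eventually.of_forall fun s => norm_nonneg _) ?_ hb
      have hQ : ∀ᶠ s : ℂ in Bornology.cobounded ℂ ⊓ 𝓟 Q4, s ∈ Q4 :=
        mem_inf_of_right (mem_principal_self _)
      filter_upwards [hQ, hne] with s hs hs0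
      have hn : ‖s‖ * ‖s⁻¹‖ = 1 := by
        rw [← norm_mul, mul_inv_cancel₀ hs0, norm_one]
      rw [norm_mul, norm_pow]
      calc ‖LL μ s‖ * ‖s⁻¹‖ ^ 2 ≤ (A + B * ‖s‖) * ‖s⁻¹‖ ^ 2 := by
            gcongr
            exact hAB s hs.1
        _ = _ := by linear_combination (B * ‖s⁻¹‖) * hn
    have h := (((hinv.const_mul (lam:ℂ)).const_add (m:ℂ)).add (hL.const_mul (β:ℂ))).add
      ((hinv.pow 2).const_mul (γ:ℂ))
    rw [show (m:ℂ) + lam * 0 + β * 0 + γ * 0 ^ 2 = m by ring] at h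
    refine h.congr' ?_
    filter_upwards [hne] with s hs
    simp only [hD]
    field_simp
  have hmC : (m:ℂ) ≠ 0 := by exact_mod_cast hm.ne'
  have hlim2 : Tendsto (fun s : ℂ => s ^ 2 / D s) (Bornology.cobounded ℂ ⊓ 𝓟 Q4)
      (nhds ((1 / m : ℝ) : ℂ)) := by
    have h := hlimD.inv₀ hmC
    simp only [inv_div] at h
    convert h using 2
    push_cast
    simp
  have hlim1 : Tendsto (fun s : ℂ => 1 - γ / D s) (Bornology.cobounded ℂ ⊓ 𝓟 Q4)
      (nhds ((1 : ℝ) : ℂ)) := by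
    have h := (((hinv.pow 2).const_mul (γ:ℂ)).mul hlim2).const_sub 1
    rw [show (1:ℂ) - γ * 0 ^ 2 * ((1 / m : ℝ) : ℂ) = ((1:ℝ):ℂ) by push_cast; ring] at h
    refine h.congr' ?_
    filter_upwards [hne] with s hs
    field_simp
  -- the values on the imaginary axis
  have hKc : ∀ ω > 0, 0 ≤ Kcos ω := by
    intro ω hω
    rw [hKcos ω hω]
    exact mul_nonneg (by positivity) (integral_nonneg fun x => by positivity)
  have hDi : ∀ ω : ℝ, 0 < ω → D (-(ω * Complex.I)) =
      (⟨γ - m * ω ^ 2 + β * ω * Ksin ω, -(ω * (lam + β * Kcos ω))⟩ : ℂ) := by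
    intro ω hω
    have e := LL_imag hμ01 hμint ω hω
    rw [← hKcos ω hω, ← hKsin ω hω] at e
    simp only [hD]
    rw [e, Complex.mk_eq_add_mul_I]
    push_cast
    ring_nf
    simp only [Complex.I_sq]
    ring
  have hIm : ∀ ω : ℝ, 0 < ω → ((D (-(ω * Complex.I)))⁻¹).im = ω / 2 * r11 ω := by
    intro ω hω
    rw [hDi ω hω, hr11 ω hω, Complex.inv_im, Complex.normSq_mk]
    simp only
    rw [neg_neg, show (γ - m * ω ^ 2 + β * ω * Ksin ω) * (γ - m * ω ^ 2 + β * ω * Ksin ω) +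
      -(ω * (lam + β * Kcos ω)) * -(ω * (lam + β * Kcos ω)) =
      (γ - m * ω ^ 2 + β * ω * Ksin ω) ^ 2 + ω ^ 2 * (lam + β * Kcos ω) ^ 2 by ring]
    ring
  have hrpos : ∀ ω : ℝ, 0 < ω → 0 ≤ r11 ω := by
    intro ω hω
    rw [hr11 ω hω]
    have := hKc ω hω
    positivity
  have hIm1 : ∀ ω : ℝ, 0 < ω → (1 - γ / D (-(ω * Complex.I))).im = -(γ * (ω / 2 * r11 ω)) := by
    intro ω hω
    rw [div_eq_mul_inv, Complex.sub_im, Complex.im_ofReal_mul, hIm ω hω, Complex.one_im, zero_sub]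
  have hIm2 : ∀ ω : ℝ, 0 < ω → ((-(ω * Complex.I)) ^ 2 / D (-(ω * Complex.I))).im =
      -(ω ^ 2 * (ω / 2 * r11 ω)) := by
    intro ω hω
    have : (-((ω:ℂ) * Complex.I)) ^ 2 = ((-ω ^ 2 : ℝ) : ℂ) := by
      rw [neg_sq, mul_pow, Complex.I_sq]
      push_cast
      ring
    rw [this, div_eq_mul_inv, Complex.im_ofReal_mul, hIm ω hω]
    ring
  have q1 := quadrant (fun s => 1 - γ / D s)
    (continuousOn_const.sub (continuousOn_const.div hDc hDne))
    (fun s h1 h2 => (differentiableAt_const _).sub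
      ((differentiableAt_const _).div (hDd s h1) (hDne s ⟨h1.le, h2.le⟩))) 1
    (fun u _ => by
      beta_reduce
      rw [hDr, ← Complex.ofReal_div, ← Complex.ofReal_one, ← Complex.ofReal_sub, Complex.ofReal_im])
    (by
      have : (γ:ℂ) ≠ 0 := by exact_mod_cast hγ.ne'
      simp only [hD0]
      rw [div_self this, sub_self])
    hlim1
    (fun ω hω => by
      rw [hIm1 ω hω]
      have := hrpos ω hω
      have : 0 ≤ γ * (ω / 2 * r11 ω) := by positivity
      linarith)
  have q2 := quadrant (fun s => s ^ 2 / D s)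
    ((continuousOn_id.pow 2).div hDc hDne)
    (fun s h1 h2 => ((differentiableAt_id).pow 2).div (hDd s h1) (hDne s ⟨h1.le, h2.le⟩)) (1 / m)
    (fun u _ => by
      beta_reduce
      rw [hDr, ← Complex.ofReal_pow, ← Complex.ofReal_div, Complex.ofReal_im])
    (by simp)
    hlim2
    (fun ω hω => by
      rw [hIm2 ω hω]
      have := hrpos ω hω
      have : 0 ≤ ω ^ 2 * (ω / 2 * r11 ω) := by positivity
      linarith)
  constructor
  · have e : ∫ ω in Ioi (0:ℝ), -(1 - γ / D (-(ω * Complex.I))).im / ω =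
        ∫ ω in Ioi (0:ℝ), γ / 2 * r11 ω := by
      refine setIntegral_congr_fun measurableSet_Ioi fun ω hω => ?_
      have hω : 0 < ω := hω
      rw [hIm1 ω hω]
      field_simp
    rw [e, integral_const_mul] at q1
    field_simp at q1 ⊢
    linarith
  · have e : ∫ ω in Ioi (0:ℝ), -((-(ω * Complex.I)) ^ 2 / D (-(ω * Complex.I))).im / ω =
        ∫ ω in Ioi (0:ℝ), 1 / 2 * (ω ^ 2 * r11 ω) := by
      refine setIntegral_congr_fun measurableSet_Ioi fun ω hω => ?_
      have hω : 0 < ω := hω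
      rw [hIm2 ω hω]
      field_simp
    rw [e, integral_const_mul] at q2
    field_simp at q2 ⊢
    linarith
end
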